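/- arXiv:1809.05543 — 9 statements merged into one kernel-verified Lean document; each statement's English description precedes it below -/
import Mathlib

section
/- Let (Ω, M, P) be a probability space, let ξ be a P-integrable real random variable, and let (X_t)_{t ∈ T} be a non-empty net of complete sub-σ-fields of M indexed by a directed set (T, ≤) such that X_t ⊆ X_s whenever s ≤ t. Then the net (E[ξ | X_t])_{t ∈ T} converges in L¹(P) to E[ξ | ⋂_{t ∈ T} X_t]. -/
open MeasureTheory ProbabilityTheory Filter

/-- The σ-field `0_Λ` of `P`-trivial events: events of the ambient σ-field `m` whose
probability is `0` or `1`. -/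
def zeroLambda {Ω : Type*} (m : MeasurableSpace Ω) (P : @MeasureTheory.Measure Ω m) :
    MeasurableSpace Ω :=
  MeasurableSpace.generateFrom {A : Set Ω | MeasurableSet[m] A ∧ (P A = 0 ∨ P A = 1)}

/-- Orthogonal projections onto an antitone family of subspaces of a Hilbert space converge
pointwise to the orthogonal projection onto the intersection. -/
theorem Submodule.starProjection_tendsto_iInf {𝕜 E ι : Type*} [RCLike 𝕜] [NormedAddCommGroup E]
    [InnerProductSpace 𝕜 E] [CompleteSpace E] [Preorder ι] (U : ι → Submodule 𝕜 E)
    [∀ i, (U i).HasOrthogonalProjection] [(⨅ i, U i).HasOrthogonalProjection]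
    (hU : Antitone U) (x : E) :
    Tendsto (fun i => (U i).starProjection x) atTop (nhds ((⨅ i, U i).starProjection x)) := by
  have h := Submodule.starProjection_tendsto_closure_iSup (fun i => (U i)ᗮ)
    (fun i j hij => Submodule.orthogonal_le (hU hij)) x
  have hinf : (⨆ i, (U i)ᗮ).topologicalClosure = (⨅ i, U i)ᗮ := by
    rw [← Submodule.orthogonal_orthogonal_eq_closure, ← Submodule.iInf_orthogonal]
    simp only [Submodule.orthogonal_orthogonal]
  simp only [hinf, Submodule.starProjection_orthogonal_val] at h
  simpa using h.const_sub x

/-- If a σ-field contains all trivial events, almost everywhere equality with a measurable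
function preserves measurability. -/
theorem Measurable.of_ae_eq_of_zeroLambda_le {Ω β : Type*} {m : MeasurableSpace Ω}
    [MeasurableSpace β] {P : Measure Ω} {n : MeasurableSpace Ω} (hn : n ≤ m)
    (h0 : zeroLambda m P ≤ n) {f g : Ω → β} (hf : Measurable[m] f) (hg : Measurable[n] g)
    (hfg : f =ᵐ[P] g) : Measurable[n] f := by
  have hnull : ∀ N : Set Ω, MeasurableSet[m] N → P N = 0 → MeasurableSet[n] N := fun N hN hP =>
    h0 N (MeasurableSpace.measurableSet_generateFrom ⟨hN, Or.inl hP⟩)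
  intro B hB
  have hfB : MeasurableSet[m] (f ⁻¹' B) := hf hB
  have hgB : MeasurableSet[n] (g ⁻¹' B) := hg hB
  have hset : f ⁻¹' B =ᵐ[P] g ⁻¹' B := hfg.preimage B
  have h₁ := hnull _ (hfB.diff (hn _ hgB)) (ae_eq_set.1 hset).1
  have h₂ := hnull _ ((hn _ hgB).diff hfB) (ae_eq_set.1 hset).2
  have heq : f ⁻¹' B = (g ⁻¹' B \ (g ⁻¹' B \ f ⁻¹' B)) ∪ (f ⁻¹' B \ g ⁻¹' B) := by
    ext ω; simp only [Set.mem_union, Set.mem_sdiff]; tauto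
  rw [heq]
  exact MeasurableSet.union (MeasurableSet.diff hgB h₂) h₁

/-- For σ-fields containing all trivial events, being a.e. strongly measurable with respect to
each of them is the same as being so with respect to their intersection. -/
theorem lpMeas_iInf {Ω T : Type*} {m : MeasurableSpace Ω} (P : Measure Ω) [Nonempty T]
    (X : T → MeasurableSpace Ω) (hXm : ∀ t, X t ≤ m) (hXc : ∀ t, zeroLambda m P ≤ X t)
    (p : ENNReal) :
    lpMeas ℝ ℝ (⨅ t, X t) p P = ⨅ t, lpMeas ℝ ℝ (X t) p P := by
  ext f
  simp only [Submodule.mem_iInf, mem_lpMeas_iff_aestronglyMeasurable]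
  refine ⟨fun hf t => hf.mono (iInf_le X t), fun hf => ?_⟩
  refine ⟨f, Measurable.stronglyMeasurable (measurable_iff_comap_le.2 (le_iInf fun t => ?_)),
    ae_eq_rfl⟩
  rw [← measurable_iff_comap_le]
  obtain ⟨g, hg, hfg⟩ := hf t
  exact .of_ae_eq_of_zeroLambda_le (hXm t) (hXc t) (Lp.stronglyMeasurable f).measurable
    hg.measurable hfg

/-- `L²` convergence of conditional expectations along a nonincreasing net of complete
σ-fields. -/
theorem tendsto_condExpL2_iInf {Ω T : Type*} {m : MeasurableSpace Ω} (P : Measure Ω)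
    [Preorder T] [Nonempty T] (X : T → MeasurableSpace Ω) (hXm : ∀ t, X t ≤ m)
    (hXc : ∀ t, zeroLambda m P ≤ X t) (hX : Antitone X) (hinf : ⨅ t, X t ≤ m) (f : Lp ℝ 2 P) :
    Tendsto (fun t => (condExpL2 ℝ ℝ (hXm t) f : Lp ℝ 2 P)) atTop
      (nhds (condExpL2 ℝ ℝ hinf f : Lp ℝ 2 P)) := by
  have := fun t => Fact.mk (hXm t)
  have := Fact.mk hinf
  have key := lpMeas_iInf P X hXm hXc 2
  have : (⨅ t, lpMeas ℝ ℝ (X t) 2 P).HasOrthogonalProjection := key ▸ inferInstance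
  have h := Submodule.starProjection_tendsto_iInf (fun t => lpMeas ℝ ℝ (X t) 2 P)
    (fun s t hst f hf => mem_lpMeas_iff_aestronglyMeasurable.2
      ((mem_lpMeas_iff_aestronglyMeasurable.1 hf).mono (hX hst))) f
  simp only [← key] at h
  exact h

/-- `L¹` convergence of conditional expectations of a square-integrable function along a
nonincreasing net of complete σ-fields. -/
theorem MeasureTheory.MemLp.tendsto_eLpNorm_condExp_iInf {Ω T : Type*} {m : MeasurableSpace Ω}
    {P : Measure Ω} [IsProbabilityMeasure P] [Preorder T] [Nonempty T]
    (X : T → MeasurableSpace Ω) (hXm : ∀ t, X t ≤ m) (hXc : ∀ t, zeroLambda m P ≤ X t)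
    (hX : Antitone X) {g : Ω → ℝ} (hg : MemLp g 2 P) :
    Tendsto (fun t => eLpNorm (P[g | X t] - P[g | ⨅ s, X s]) 1 P) atTop (nhds 0) := by
  have hinf : ⨅ t, X t ≤ m := (iInf_le X (Classical.arbitrary T)).trans (hXm _)
  have h := (Lp.tendsto_Lp_iff_tendsto_eLpNorm' _ _).1
    (tendsto_condExpL2_iInf P X hXm hXc hX hinf hg.toLp)
  refine tendsto_of_tendsto_of_tendsto_of_le_of_le tendsto_const_nhds h (fun _ => zero_le)
    fun t => ?_
  have hae : P[g | X t] - P[g | ⨅ s, X s] =ᵐ[P]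
      ⇑(condExpL2 ℝ ℝ (hXm t) hg.toLp : Lp ℝ 2 P) - ⇑(condExpL2 ℝ ℝ hinf hg.toLp : Lp ℝ 2 P) :=
    (hg.condExpL2_ae_eq_condExp (𝕜 := ℝ) (hXm t)).symm.sub
      (hg.condExpL2_ae_eq_condExp (𝕜 := ℝ) hinf).symm
  calc eLpNorm (P[g | X t] - P[g | ⨅ s, X s]) 1 P
      ≤ eLpNorm (P[g | X t] - P[g | ⨅ s, X s]) 2 P :=
        eLpNorm_le_eLpNorm_of_exponent_le one_le_two
          (integrable_condExp.sub integrable_condExp).aestronglyMeasurable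
    _ = _ := eLpNorm_congr_ae hae

/-- Replacing `f` by `g` changes the `L¹` distance between two conditional expectations by at
most twice the `L¹` distance of `f` and `g`. -/
theorem eLpNorm_condExp_sub_condExp_le {Ω : Type*} {m : MeasurableSpace Ω} {P : Measure Ω}
    (n₁ n₂ : MeasurableSpace Ω) {f g : Ω → ℝ} (hf : Integrable f P) (hg : Integrable g P) :
    eLpNorm (P[f | n₁] - P[f | n₂]) 1 P ≤
      eLpNorm (P[g | n₁] - P[g | n₂]) 1 P + 2 * eLpNorm (f - g) 1 P := by
  have hae : P[f | n₁] - P[f | n₂] =ᵐ[P]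
      (P[g | n₁] - P[g | n₂]) + (P[f - g | n₁] - P[f - g | n₂]) := by
    filter_upwards [condExp_sub hf hg n₁, condExp_sub hf hg n₂] with ω h₁ h₂
    simp only [Pi.add_apply, Pi.sub_apply, h₁, h₂]
    ring
  have hm : ∀ (n : MeasurableSpace Ω) (h : Ω → ℝ), AEStronglyMeasurable[m] (P[h | n]) P :=
    fun n h => (integrable_condExp (m := n) (f := h)).aestronglyMeasurable
  rw [eLpNorm_congr_ae hae]
  refine (eLpNorm_add_le ((hm _ _).sub (hm _ _)) ((hm _ _).sub (hm _ _)) le_rfl).trans ?_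
  gcongr
  refine (eLpNorm_sub_le (hm _ _) (hm _ _) le_rfl).trans ?_
  rw [two_mul]
  exact add_le_add (eLpNorm_condExp_le_eLpNorm _ le_rfl) (eLpNorm_condExp_le_eLpNorm _ le_rfl)

/-- **Decreasing martingale convergence along a directed set.**
If `(X_t)_{t ∈ T}` is a net of complete sub-σ-fields, nonincreasing in the sense that
`s ≤ t → X t ≤ X s`, then `E[ξ | X_t] → E[ξ | ⋂_t X_t]` in `L¹(P)` along the net. -/
theorem stmt3 {Ω : Type*} {m : MeasurableSpace Ω} (P : Measure Ω) [IsProbabilityMeasure P]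
    {T : Type*} [Preorder T] [IsDirected T (· ≤ ·)] [Nonempty T]
    (X : T → MeasurableSpace Ω) (hXm : ∀ t, X t ≤ m)
    (hXc : ∀ t, zeroLambda m P ≤ X t)
    (hmono : ∀ s t : T, s ≤ t → X t ≤ X s)
    (ξ : Ω → ℝ) (hξ : Integrable ξ P) :
    Tendsto (fun t : T => ∫ ω, |(P[ξ | X t]) ω - (P[ξ | ⨅ s, X s]) ω| ∂P)
      atTop (nhds 0) := by
  have hL1 : Tendsto (fun t => eLpNorm (P[ξ | X t] - P[ξ | ⨅ s, X s]) 1 P) atTop (nhds 0) := by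
    rw [ENNReal.tendsto_nhds_zero]
    intro ε hε
    obtain ⟨g, hg, -⟩ := (memLp_one_iff_integrable.2 hξ).exists_simpleFunc_eLpNorm_sub_lt
      ENNReal.one_ne_top (ε := ε / 4) (ENNReal.div_pos hε.ne' (by simp)).ne'
    have hg2 : MemLp g 2 P := g.memLp_of_isFiniteMeasure 2 P
    have hlim := hg2.tendsto_eLpNorm_condExp_iInf X hXm hXc (fun s t => hmono s t)
    filter_upwards [ENNReal.tendsto_nhds_zero.1 hlim (ε / 2) (ENNReal.div_pos hε.ne' (by simp))]
      with t ht
    calc eLpNorm (P[ξ | X t] - P[ξ | ⨅ s, X s]) 1 P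
        ≤ eLpNorm (P[⇑g | X t] - P[⇑g | ⨅ s, X s]) 1 P + 2 * eLpNorm (ξ - ⇑g) 1 P :=
          eLpNorm_condExp_sub_condExp_le _ _ hξ (hg2.integrable one_le_two)
      _ ≤ ε / 2 + 2 * (ε / 4) := by gcongr
      _ = ε := by
        have h4 : (2 : ENNReal) * (ε / 4) = ε / 2 := by
          rw [show (4 : ENNReal) = 2 * 2 by norm_num, ← mul_div_assoc,
            ENNReal.mul_div_mul_left _ _ two_ne_zero ENNReal.ofNat_ne_top]
        rw [h4, ENNReal.add_halves]
  have hint : ∀ t, ∫ ω, |(P[ξ | X t]) ω - (P[ξ | ⨅ s, X s]) ω| ∂P =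
      (eLpNorm (P[ξ | X t] - P[ξ | ⨅ s, X s]) 1 P).toReal := fun t => by
    rw [eLpNorm_one_eq_lintegral_enorm, ← integral_norm_eq_lintegral_enorm
      (integrable_condExp.sub integrable_condExp).aestronglyMeasurable]
    rfl
  simp only [hint]
  exact (ENNReal.tendsto_toReal ENNReal.zero_ne_top).comp hL1
end

section
/- Let X and Y be complete sub-σ-fields of a probability space (Ω, M, P). The following are equivalent: (i) X and Y are independent; (ii) X ∧ Y = 0_Λ and for every P-integrable real f, E[E[f | Y] | X] = E[E[f | X] | Y] almost surely; (iii) for every P-integrable real f, E[E[f | Y] | X] = E[f] almost surely. -/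
open MeasureTheory ProbabilityTheory

theorem measurableSet_zeroLambda_iff {Ω : Type*} {m : MeasurableSpace Ω} {P : Measure Ω}
    [IsProbabilityMeasure P] {A : Set Ω} :
    MeasurableSet[zeroLambda m P] A ↔ MeasurableSet[m] A ∧ (P A = 0 ∨ P A = 1) := by
  refine ⟨fun h => ?_, fun h => MeasurableSpace.measurableSet_generateFrom h⟩
  induction A, h using MeasurableSpace.generateFrom_induction with
  | hC t ht _ => exact ht
  | empty => simp
  | compl t _ ih =>
    refine ⟨ih.1.compl, ?_⟩
    rw [prob_compl_eq_one_iff ih.1, prob_compl_eq_zero_iff ih.1]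
    exact ih.2.symm
  | iUnion s _ ih =>
    refine ⟨MeasurableSet.iUnion fun n => (ih n).1, ?_⟩
    by_cases h : ∀ n, P (s n) = 0
    · exact Or.inl (measure_iUnion_null h)
    · push Not at h
      obtain ⟨n, hn⟩ := h
      refine Or.inr (le_antisymm prob_le_one ?_)
      rw [← (ih n).2.resolve_left hn]
      exact measure_mono (Set.subset_iUnion s n)

theorem indep_zeroLambda_self {Ω : Type*} {m : MeasurableSpace Ω} (P : Measure Ω)
    [IsProbabilityMeasure P] : Indep (zeroLambda m P) (zeroLambda m P) P := by
  rw [Indep_iff]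
  intro A B hA hB
  obtain ⟨hAm, hA | hA⟩ := measurableSet_zeroLambda_iff.1 hA
  · rw [hA, zero_mul]
    exact measure_mono_null Set.inter_subset_left hA
  · rw [hA, one_mul, Set.inter_comm]
    exact measure_inter_conull ((prob_compl_eq_zero_iff hAm).2 hA)

/-- A measurable function that agrees almost everywhere with a function measurable for a complete
sub-σ-field is itself measurable for it. -/
theorem measurable_of_ae_eq_of_zeroLambda_le {Ω : Type*} {m : MeasurableSpace Ω} {P : Measure Ω}
    {Y : MeasurableSpace Ω} (hYm : Y ≤ m) (hYc : zeroLambda m P ≤ Y) {g h : Ω → ℝ}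
    (hg : Measurable[m] g) (hh : Measurable[Y] h) (hgh : g =ᵐ[P] h) : Measurable[Y] g := by
  have null : ∀ s : Set Ω, MeasurableSet[m] s → P s = 0 → MeasurableSet[Y] s := fun s hs h0 =>
    hYc s (MeasurableSpace.measurableSet_generateFrom ⟨hs, Or.inl h0⟩)
  have hhm : Measurable[m] h := hh.mono hYm le_rfl
  have hN : MeasurableSet[m] {ω | g ω = h ω}ᶜ := (measurableSet_eq_fun hg hhm).compl
  have hN0 : P {ω | g ω = h ω}ᶜ = 0 := hgh
  intro s hs
  have key : g ⁻¹' s = h ⁻¹' s \ {ω | g ω = h ω}ᶜ ∪ g ⁻¹' s ∩ {ω | g ω = h ω}ᶜ := by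
    ext ω
    by_cases hω : g ω = h ω <;> simp [hω]
  rw [key]
  exact ((hh hs).diff (null _ hN hN0)).union
    (null _ ((hg hs).inter hN) (measure_mono_null Set.inter_subset_right hN0))

theorem condExp_condExp_ae_eq_integral_of_indep {Ω : Type*} {m : MeasurableSpace Ω}
    {P : Measure Ω} [IsProbabilityMeasure P] {X Y : MeasurableSpace Ω} (hXm : X ≤ m) (hYm : Y ≤ m)
    (h : Indep X Y P) (f : Ω → ℝ) : P[P[f|Y]|X] =ᵐ[P] fun _ => ∫ ω, f ω ∂P := by
  have := condExp_indep_eq hYm hXm (stronglyMeasurable_condExp (f := f) (μ := P)) h.symm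
  rwa [integral_condExp hYm] at this

theorem indep_of_condExp_condExp_ae_eq_integral {Ω : Type*} {m : MeasurableSpace Ω}
    {P : Measure Ω} [IsProbabilityMeasure P] {X Y : MeasurableSpace Ω} (hXm : X ≤ m) (hYm : Y ≤ m)
    (h : ∀ f : Ω → ℝ, Integrable f P → P[P[f|Y]|X] =ᵐ[P] fun _ => ∫ ω, f ω ∂P) :
    Indep X Y P := by
  rw [Indep_iff]
  intro A B hA hB
  have hBi : Integrable (B.indicator fun _ => (1 : ℝ)) P :=
    (integrable_const 1).indicator (hYm B hB)
  have hB' := h _ hBi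
  rw [condExp_of_stronglyMeasurable hYm (stronglyMeasurable_const.indicator hB) hBi] at hB'
  have key := setIntegral_condExp hXm hBi hA
  rw [integral_congr_ae (ae_restrict_of_ae hB'), integral_indicator_const _ (hYm B hB),
    setIntegral_const, integral_indicator_const _ (hYm B hB),
    measureReal_restrict_apply (hYm B hB), Set.inter_comm] at key
  simp only [smul_eq_mul, mul_one] at key
  rw [← ENNReal.toReal_eq_toReal_iff' (by finiteness) (by finiteness), ENNReal.toReal_mul]
  exact key.symm

theorem inf_eq_zeroLambda_of_indep {Ω : Type*} {m : MeasurableSpace Ω}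
    {P : Measure Ω} [IsProbabilityMeasure P] {X Y : MeasurableSpace Ω} (hXm : X ≤ m)
    (hXc : zeroLambda m P ≤ X) (hYc : zeroLambda m P ≤ Y) (h : Indep X Y P) :
    X ⊓ Y = zeroLambda m P := by
  refine le_antisymm (fun A hA => ?_) (le_inf hXc hYc)
  obtain ⟨hAX, hAY⟩ := MeasurableSpace.measurableSet_inf.1 hA
  exact measurableSet_zeroLambda_iff.2 ⟨hXm A hAX,
    measure_eq_zero_or_one_of_indepSet_self (h.indepSet_of_measurableSet hAX hAY)⟩

theorem condExp_condExp_ae_eq_integral_of_comm {Ω : Type*} {m : MeasurableSpace Ω}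
    {P : Measure Ω} [IsProbabilityMeasure P] {X Y : MeasurableSpace Ω} (hXm : X ≤ m) (hYm : Y ≤ m)
    (hYc : zeroLambda m P ≤ Y) (hXY : X ⊓ Y = zeroLambda m P) {f : Ω → ℝ}
    (hf : P[P[f|Y]|X] =ᵐ[P] P[P[f|X]|Y]) : P[P[f|Y]|X] =ᵐ[P] fun _ => ∫ ω, f ω ∂P := by
  have hX : Measurable[X] (P[P[f|Y]|X]) := stronglyMeasurable_condExp.measurable
  have hY : Measurable[Y] (P[P[f|Y]|X]) :=
    measurable_of_ae_eq_of_zeroLambda_le hYm hYc (hX.mono hXm le_rfl)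
      stronglyMeasurable_condExp.measurable hf
  have h0 : StronglyMeasurable[zeroLambda m P] (P[P[f|Y]|X]) := by
    refine Measurable.stronglyMeasurable fun s hs => ?_
    rw [← hXY]
    exact MeasurableSpace.measurableSet_inf.2 ⟨hX hs, hY hs⟩
  have hm : zeroLambda m P ≤ m := hYc.trans hYm
  have := condExp_indep_eq hm hm h0 (indep_zeroLambda_self P)
  rwa [condExp_of_stronglyMeasurable hm h0 integrable_condExp, integral_condExp hXm,
    integral_condExp hYm] at this

/-- **Independence and commutativity of conditional expectations.**
For complete sub-σ-fields `X`, `Y`, the following are equivalent: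
(i) `X ⟂ Y`; (ii) `X ∧ Y = 0_Λ` and the conditional expectation operators commute;
(iii) `E[E[f|Y]|X] = E[f]` a.s. for every integrable `f`. -/
theorem stmt4 {Ω : Type*} {m : MeasurableSpace Ω} (P : Measure Ω) [IsProbabilityMeasure P]
    (X Y : MeasurableSpace Ω) (hXm : X ≤ m) (hYm : Y ≤ m)
    (hXc : zeroLambda m P ≤ X) (hYc : zeroLambda m P ≤ Y) :
    [Indep X Y P,
      X ⊓ Y = zeroLambda m P ∧
        ∀ f : Ω → ℝ, Integrable f P → P[P[f|Y]|X] =ᵐ[P] P[P[f|X]|Y],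
      ∀ f : Ω → ℝ, Integrable f P → P[P[f|Y]|X] =ᵐ[P] fun _ => ∫ ω, f ω ∂P].TFAE := by
  tfae_have 1 → 3 := fun h f _ => condExp_condExp_ae_eq_integral_of_indep hXm hYm h f
  tfae_have 3 → 1 := indep_of_condExp_condExp_ae_eq_integral hXm hYm
  tfae_have 1 → 2 := fun h => ⟨inf_eq_zeroLambda_of_indep hXm hXc hYc h, fun f _ =>
    (condExp_condExp_ae_eq_integral_of_indep hXm hYm h f).trans
      (condExp_condExp_ae_eq_integral_of_indep hYm hXm h.symm f).symm⟩
  tfae_have 2 → 3 := fun h f hf =>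
    condExp_condExp_ae_eq_integral_of_comm hXm hYm hYc h.1 (h.2 f hf)
  tfae_finish
end

section
/- Let (X_{αβ})_{(α,β) ∈ 𝔄 × 𝔅} be a family of complete sub-σ-fields of a probability space (Ω, M, P), with 𝔄 non-empty. Suppose the σ-fields Z_β := ⋁_{α ∈ 𝔄} X_{αβ}, β ∈ 𝔅, form an independent family. Then ⋀_{α ∈ 𝔄} ⋁_{β ∈ 𝔅} X_{αβ} = ⋁_{β ∈ 𝔅} ⋀_{α ∈ 𝔄} X_{αβ}. -/
open MeasureTheory ProbabilityTheory

open Set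

lemma sup_iSup_compl_singleton {L κ : Type*} [CompleteLattice L] {f : κ → L} (k₀ : κ) :
    f k₀ ⊔ ⨆ k ∈ ({k₀}ᶜ : Set κ), f k = ⨆ k, f k := by
  refine le_antisymm ?_ ?_
  · exact sup_le (le_iSup f k₀) (iSup₂_le fun k _ => le_iSup f k)
  · refine iSup_le fun k => ?_
    by_cases hk : k = k₀
    · simp [hk]
    · exact le_sup_of_le_right (le_iSup₂_of_le k hk le_rfl)

section Complete

variable {Ω : Type*} {X m : MeasurableSpace Ω} {P : Measure Ω}

lemma measurableSet_of_measure_zero (hX : zeroLambda m P ≤ X) {A : Set Ω}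
    (hA : MeasurableSet[m] A) (h0 : P A = 0) : MeasurableSet[X] A :=
  hX _ (MeasurableSpace.measurableSet_generateFrom ⟨hA, Or.inl h0⟩)

lemma measurableSet_of_ae_eq (hXm : X ≤ m) (hX : zeroLambda m P ≤ X) {A B : Set Ω}
    (hA : MeasurableSet[m] A) (hB : MeasurableSet[X] B) (hAB : A =ᵐ[P] B) :
    MeasurableSet[X] A := by
  have h := ae_eq_set.1 hAB
  have h1 : MeasurableSet[X] (A \ B) :=
    measurableSet_of_measure_zero hX (hA.diff (hXm _ hB)) h.1
  have h2 : MeasurableSet[X] (B \ A) :=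
    measurableSet_of_measure_zero hX ((hXm _ hB).diff hA) h.2
  have : A = (B \ (B \ A)) ∪ (A \ B) := by
    ext x
    by_cases hx : x ∈ A <;> by_cases hy : x ∈ B <;> simp [hx, hy]
  rw [this]
  exact MeasurableSet.union (MeasurableSet.diff hB h2) h1

lemma measurable_of_aestronglyMeasurable (hXm : X ≤ m) (hX : zeroLambda m P ≤ X)
    {f : Ω → ℝ} (hf : Measurable[m] f) (hfX : AEStronglyMeasurable[X] f P) :
    Measurable[X] f := by
  obtain ⟨g, hg, hfg⟩ := hfX
  intro s hs
  exact measurableSet_of_ae_eq hXm hX (hf hs) (hg.measurable hs) (hfg.preimage s)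

end Complete

section CondExp

lemma ae_abs_condExp_indicator_le {Ω : Type*} {X m : MeasurableSpace Ω} {P : Measure Ω}
    (C : Set Ω) :
    ∀ᵐ x ∂P, |(P[C.indicator (fun _ => (1 : ℝ)) | X]) x| ≤ 1 := by
  refine ae_bdd_abs_condExp_of_ae_bdd_abs (R := 1) (Filter.Eventually.of_forall fun x => ?_)
  by_cases hx : x ∈ C <;> simp [hx]

variable {Ω : Type*} {X Y Z m : MeasurableSpace Ω} {P : Measure Ω} [IsProbabilityMeasure P]

lemma condExp_eq_zero_iff_setIntegral (hX : X ≤ m) {u : Ω → ℝ} (hu : Integrable u P) :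
    P[u | X] =ᵐ[P] 0 ↔ ∀ s, MeasurableSet[X] s → ∫ x in s, u x ∂P = 0 := by
  constructor
  · intro h s hs
    rw [← setIntegral_condExp hX hu hs, setIntegral_congr_ae (g := fun _ => 0)
      (hX _ hs) (by filter_upwards [h] with x hx _ using hx)]
    simp
  · intro h
    refine (ae_eq_condExp_of_forall_setIntegral_eq hX hu ?_ ?_ ?_).symm
    · intro s _ _
      exact (integrable_zero _ _ _).integrableOn
    · intro s hs _
      simp [h s hs]
    · exact stronglyMeasurable_zero.aestronglyMeasurable

lemma condExp_eq_zero_of_isPiSystem (hX : X ≤ m) {S : Set (Set Ω)}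
    (hS : X = MeasurableSpace.generateFrom S) (hpi : IsPiSystem S) {u : Ω → ℝ}
    (hu : Integrable u P) (huniv : ∫ x, u x ∂P = 0) (h : ∀ s ∈ S, ∫ x in s, u x ∂P = 0) :
    P[u | X] =ᵐ[P] 0 := by
  rw [condExp_eq_zero_iff_setIntegral hX hu]
  refine MeasurableSpace.induction_on_inter hS hpi (by simp) h ?_ ?_
  · intro t ht h0
    have := integral_add_compl (hX _ ht) hu
    linarith
  · intro f hd hf h0
    rw [integral_iUnion (fun i => hX _ (hf i)) hd hu.integrableOn]
    simp [h0]

lemma condExp_sup_eq_zero (hX : X ≤ m) (hY : Y ≤ m) {u : Ω → ℝ} (hu : Integrable u P)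
    (h : ∀ A B, MeasurableSet[X] A → MeasurableSet[Y] B → ∫ x in A ∩ B, u x ∂P = 0) :
    P[u | X ⊔ Y] =ᵐ[P] 0 := by
  refine condExp_eq_zero_of_isPiSystem (sup_le hX hY)
    (S := image2 (· ∩ ·) {A | MeasurableSet[X] A} {B | MeasurableSet[Y] B}) ?_ ?_ hu ?_ ?_
  · refine le_antisymm (sup_le ?_ ?_) (MeasurableSpace.generateFrom_le ?_)
    · intro A hA
      exact MeasurableSpace.measurableSet_generateFrom
        ⟨A, hA, univ, MeasurableSet.univ, inter_univ A⟩
    · intro B hB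
      exact MeasurableSpace.measurableSet_generateFrom
        ⟨univ, MeasurableSet.univ, B, hB, univ_inter B⟩
    · rintro _ ⟨A, hA, B, hB, rfl⟩
      exact MeasurableSet.inter ((le_sup_left : X ≤ X ⊔ Y) _ hA)
        ((le_sup_right : Y ≤ X ⊔ Y) _ hB)
  · rintro _ ⟨A, hA, B, hB, rfl⟩ _ ⟨A', hA', B', hB', rfl⟩ _
    exact ⟨A ∩ A', MeasurableSet.inter hA hA', B ∩ B', MeasurableSet.inter hB hB',
      inter_inter_inter_comm _ _ _ _⟩
  · simpa using h univ univ MeasurableSet.univ MeasurableSet.univ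
  · rintro _ ⟨A, hA, B, hB, rfl⟩
    exact h A B hA hB

lemma condExp_sup_eq_zero_of_indep (hZ : Z ≤ m) (hY : Y ≤ m) (hXZ : X ≤ Z)
    (hind : Indep Z Y P) {w : Ω → ℝ} (hw : StronglyMeasurable[Z] w) (hwi : Integrable w P)
    (h0 : P[w | X] =ᵐ[P] 0) : P[w | X ⊔ Y] =ᵐ[P] 0 := by
  refine condExp_sup_eq_zero (hXZ.trans hZ) hY hwi fun A B hA hB => ?_
  have hAm := hZ _ (hXZ _ hA)
  have hwA : Integrable (A.indicator w) P := hwi.indicator hAm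
  have hA0 : ∫ x, A.indicator w x ∂P = 0 := by
    rw [integral_indicator hAm]
    exact (condExp_eq_zero_iff_setIntegral (hXZ.trans hZ) hwi).1 h0 A hA
  have hc : P[A.indicator w | Y] =ᵐ[P] 0 := by
    filter_upwards [condExp_indep_eq hZ hY (hw.indicator (hXZ _ hA)) hind] with x hx
    rw [hx, hA0]
    rfl
  have := (condExp_eq_zero_iff_setIntegral hY hwA).1 hc B hB
  rwa [setIntegral_indicator hAm, inter_comm] at this

lemma integral_mul_condExp_indicator (hX : X ≤ m) {v : Ω → ℝ} (hv : Integrable v P)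
    {C : Set Ω} (hC : MeasurableSet[m] C) :
    ∫ x, v x * (P[C.indicator (fun _ => (1 : ℝ)) | X]) x ∂P
      = ∫ x in C, (P[v | X]) x ∂P := by
  set g : Ω → ℝ := C.indicator fun _ => 1 with hg
  have hgi : Integrable g P := (integrable_const 1).indicator hC
  have hbd : ∀ᵐ x ∂P, ‖(P[g | X]) x‖ ≤ 1 := ae_abs_condExp_indicator_le C
  have h1 : P[v * P[g | X] | X] =ᵐ[P] P[v | X] * P[g | X] :=
    condExp_mul_of_stronglyMeasurable_right stronglyMeasurable_condExp
      (hv.mul_bdd integrable_condExp.aestronglyMeasurable hbd) hv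
  have hgb : ∀ᵐ x ∂P, ‖g x‖ ≤ 1 := Filter.Eventually.of_forall fun x => by
    by_cases hx : x ∈ C <;> simp [hg, hx]
  have h2 : P[P[v | X] * g | X] =ᵐ[P] P[v | X] * P[g | X] :=
    condExp_mul_of_stronglyMeasurable_left stronglyMeasurable_condExp
      (integrable_condExp.mul_bdd hgi.aestronglyMeasurable hgb) hgi
  calc ∫ x, (v * P[g | X]) x ∂P = ∫ x, (P[v * P[g | X] | X]) x ∂P := (integral_condExp hX).symm
    _ = ∫ x, (P[P[v | X] * g | X]) x ∂P := integral_congr_ae (h1.trans h2.symm)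
    _ = ∫ x, (P[v | X] * g) x ∂P := integral_condExp hX
    _ = ∫ x in C, (P[v | X]) x ∂P := by
      rw [← integral_indicator hC]
      congr 1
      ext x
      by_cases hx : x ∈ C <;> simp [hg, hx]

/-- If `Y` is independent of `Z ⊇ X`, then conditioning an `X ⊔ Y`-measurable function on `Z`
is the same as conditioning it on `X`. -/
lemma condExp_ae_eq_of_indep (hZ : Z ≤ m) (hY : Y ≤ m) (hXZ : X ≤ Z)
    (hind : Indep Z Y P) {v : Ω → ℝ} (hv : StronglyMeasurable[X ⊔ Y] v)
    (hvi : Integrable v P) : P[v | X] =ᵐ[P] P[v | Z] := by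
  have hX := hXZ.trans hZ
  refine ae_eq_condExp_of_forall_setIntegral_eq hZ hvi
    (fun s _ _ => integrable_condExp.integrableOn) (fun C hC _ => ?_)
    (stronglyMeasurable_condExp.mono hXZ).aestronglyMeasurable
  set g : Ω → ℝ := C.indicator fun _ => 1 with hg
  have hgZ : StronglyMeasurable[Z] g := stronglyMeasurable_const.indicator hC
  have hgi : Integrable g P := (integrable_const 1).indicator (hZ _ hC)
  have hbd : ∀ᵐ x ∂P, ‖(P[g | X]) x‖ ≤ 1 := ae_abs_condExp_indicator_le C
  have hgb : ∀ᵐ x ∂P, ‖g x‖ ≤ 1 := Filter.Eventually.of_forall fun x => by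
    by_cases hx : x ∈ C <;> simp [hg, hx]
  have hvg : Integrable (v * g) P := hvi.mul_bdd hgi.aestronglyMeasurable hgb
  have hvc : Integrable (v * P[g | X]) P :=
    hvi.mul_bdd integrable_condExp.aestronglyMeasurable hbd
  have hwi : Integrable (g - P[g | X]) P := hgi.sub integrable_condExp
  have hw0 : P[g - P[g | X] | X] =ᵐ[P] 0 := by
    filter_upwards [condExp_sub hgi (integrable_condExp (m := X) (f := g)) X] with x hx
    rw [hx, condExp_of_stronglyMeasurable hX stronglyMeasurable_condExp integrable_condExp]
    simp
  have hw : P[g - P[g | X] | X ⊔ Y] =ᵐ[P] 0 :=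
    condExp_sup_eq_zero_of_indep hZ hY hXZ hind
      (hgZ.sub (stronglyMeasurable_condExp.mono hXZ)) hwi hw0
  have hvw : Integrable (v * (g - P[g | X])) P := by
    rw [mul_sub]
    exact hvg.sub hvc
  have h0 : ∫ x, (v * (g - P[g | X])) x ∂P = 0 := by
    rw [← integral_condExp (sup_le hX hY), integral_congr_ae (g := fun _ => 0)]
    · simp
    · filter_upwards [condExp_mul_of_stronglyMeasurable_left hv hvw hwi, hw] with x hx hx0
      rw [hx, Pi.mul_apply, hx0]
      simp
  rw [mul_sub, integral_sub' hvg hvc, sub_eq_zero] at h0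
  rw [← integral_mul_condExp_indicator hX hvi (hZ _ hC)]
  refine Eq.trans h0.symm ?_
  rw [← integral_indicator (hZ _ hC)]
  congr 1
  ext x
  by_cases hx : x ∈ C <;> simp [hg, hx]

lemma condExp_sup_eq_zero_of_iInf {ι : Type*} [Nonempty ι] {X : ι → MeasurableSpace Ω}
    {Y' Y Z m : MeasurableSpace Ω} {P : Measure Ω} [IsProbabilityMeasure P]
    (hZ : Z ≤ m) (hY : Y ≤ m) (hXZ : ∀ i, X i ≤ Z)
    (hXc : ∀ i, zeroLambda m P ≤ X i) (hYY : Y' ≤ Y) (hind : Indep Z Y P)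
    {u : Ω → ℝ} (hui : Integrable u P) (hu : ∀ i, StronglyMeasurable[X i ⊔ Y] u)
    (h0 : P[u | (⨅ i, X i) ⊔ Y'] =ᵐ[P] 0) : P[u | Z ⊔ Y'] =ᵐ[P] 0 := by
  have hKZ : ⨅ i, X i ≤ Z := (iInf_le X (Classical.arbitrary ι)).trans (hXZ _)
  refine condExp_sup_eq_zero hZ (hYY.trans hY) hui fun A B hA hB => ?_
  have hBm := hY _ (hYY _ hB)
  have hvi : Integrable (B.indicator u) P := hui.indicator hBm
  have hK : StronglyMeasurable[⨅ i, X i] (P[B.indicator u | Z]) := by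
    have : Measurable[⨅ i, X i] (P[B.indicator u | Z]) := by
      intro s hs
      rw [MeasurableSpace.measurableSet_iInf]
      intro i
      refine measurable_of_aestronglyMeasurable ((hXZ i).trans hZ) (hXc i)
        (stronglyMeasurable_condExp.mono hZ).measurable ?_ hs
      exact ⟨_, stronglyMeasurable_condExp, (condExp_ae_eq_of_indep hZ hY (hXZ i) hind
        ((hu i).indicator ((hYY.trans le_sup_right) _ hB)) hvi).symm⟩
    exact this.stronglyMeasurable
  have hK0 : P[B.indicator u | ⨅ i, X i] =ᵐ[P] 0 := by
    rw [condExp_eq_zero_iff_setIntegral (hKZ.trans hZ) hvi]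
    intro s hs
    rw [setIntegral_indicator hBm]
    exact (condExp_eq_zero_iff_setIntegral (sup_le (hKZ.trans hZ) (hYY.trans hY)) hui).1 h0 _
      (MeasurableSet.inter ((le_sup_left : _ ≤ (⨅ i, X i) ⊔ Y') _ hs)
        ((le_sup_right : _ ≤ (⨅ i, X i) ⊔ Y') _ hB))
  have hZ0 : P[B.indicator u | Z] =ᵐ[P] 0 := by
    have := condExp_condExp_of_le (μ := P) (f := B.indicator u) hKZ hZ
    rw [condExp_of_stronglyMeasurable (hKZ.trans hZ) hK integrable_condExp] at this
    exact this.trans hK0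
  have := (condExp_eq_zero_iff_setIntegral hZ hvi).1 hZ0 A hA
  rwa [setIntegral_indicator hBm] at this

end CondExp

section Family

variable {Ω : Type*} {m : MeasurableSpace Ω} {P : Measure Ω} [IsProbabilityMeasure P]
  {ι κ : Type*} [Nonempty ι] {X : ι → κ → MeasurableSpace Ω}

open Classical in
lemma condExp_iSup_ite_eq_zero (hXm : ∀ i k, X i k ≤ m) (hXc : ∀ i k, zeroLambda m P ≤ X i k)
    (hind : iIndep (fun k => ⨆ i, X i k) P) {u : Ω → ℝ} (hui : Integrable u P)
    (hu : ∀ i, StronglyMeasurable[⨆ k, X i k] u) (h0 : P[u | ⨆ k, ⨅ i, X i k] =ᵐ[P] 0)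
    (F : Finset κ) :
    P[u | ⨆ k, if k ∈ F then ⨆ i, X i k else ⨅ i, X i k] =ᵐ[P] 0 := by
  have hZm : ∀ k, ⨆ i, X i k ≤ m := fun k => iSup_le fun i => hXm i k
  have hKZ : ∀ k, ⨅ i, X i k ≤ ⨆ i, X i k := fun k => iInf_le_iSup
  induction F using Finset.induction_on with
  | empty => simpa using h0
  | insert k₀ F hk₀ ih =>
    set Y' : MeasurableSpace Ω :=
      ⨆ k ∈ ({k₀}ᶜ : Set κ), if k ∈ F then ⨆ i, X i k else ⨅ i, X i k with hY'
    set Y : MeasurableSpace Ω := ⨆ k ∈ ({k₀}ᶜ : Set κ), ⨆ i, X i k with hY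
    have e1 : (⨆ k, if k ∈ F then ⨆ i, X i k else ⨅ i, X i k) = (⨅ i, X i k₀) ⊔ Y' := by
      rw [← sup_iSup_compl_singleton k₀]
      simp [hY', hk₀]
    have e2 : (⨆ k, if k ∈ insert k₀ F then ⨆ i, X i k else ⨅ i, X i k)
        = (⨆ i, X i k₀) ⊔ Y' := by
      rw [← sup_iSup_compl_singleton k₀]
      simp only [Finset.mem_insert_self, if_true, hY']
      congr 1
      refine iSup_congr fun k => iSup_congr fun hk => ?_
      have hk : k ≠ k₀ := hk
      simp [hk]
    rw [e2]
    rw [e1] at ih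
    refine condExp_sup_eq_zero_of_iInf (Y := Y) (hZm k₀) (iSup₂_le fun k _ => hZm k)
      (fun i => le_iSup (fun i => X i k₀) i) (fun i => hXc i k₀) ?_ ?_ hui (fun i => ?_) ih
    · refine iSup₂_mono fun k _ => ?_
      split_ifs
      exacts [le_rfl, hKZ k]
    · have := indep_iSup_of_disjoint hZm hind (S := {k₀}) (T := {k₀}ᶜ) disjoint_compl_right
      simpa [hY] using this
    · refine (hu i).mono ?_
      rw [← sup_iSup_compl_singleton k₀]
      exact sup_le_sup_left (iSup₂_mono fun k _ => le_iSup (fun i => X i k) i) _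

lemma condExp_iSup_iSup_eq_zero (hXm : ∀ i k, X i k ≤ m) (hXc : ∀ i k, zeroLambda m P ≤ X i k)
    (hind : iIndep (fun k => ⨆ i, X i k) P) {u : Ω → ℝ} (hui : Integrable u P)
    (hu : ∀ i, StronglyMeasurable[⨆ k, X i k] u) (h0 : P[u | ⨆ k, ⨅ i, X i k] =ᵐ[P] 0) :
    P[u | ⨆ k, ⨆ i, X i k] =ᵐ[P] 0 := by
  classical
  have hZm : ∀ k, ⨆ i, X i k ≤ m := fun k => iSup_le fun i => hXm i k
  have hKZ : ∀ k, ⨅ i, X i k ≤ ⨆ i, X i k := fun k => iInf_le_iSup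
  set T : Finset κ → MeasurableSpace Ω :=
    fun F => ⨆ k, if k ∈ F then ⨆ i, X i k else ⨅ i, X i k with hT
  have hTle : ∀ F, T F ≤ ⨆ k, ⨆ i, X i k := fun F => iSup_mono fun k => by
    split_ifs
    exacts [le_rfl, hKZ k]
  have hTm : ∀ F, T F ≤ m := fun F => (hTle F).trans (iSup_le hZm)
  have hmono : Monotone T := fun F G hFG => iSup_mono fun k => by
    by_cases hF : k ∈ F
    · simp [hF, hFG hF]
    · by_cases hG : k ∈ G
      · simpa [hF, hG] using hKZ k
      · simp [hF, hG]
  have h := fun F => (condExp_eq_zero_iff_setIntegral (hTm F) hui).1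
    (condExp_iSup_ite_eq_zero hXm hXc hind hui hu h0 F)
  have hsup : ⨆ k, ⨆ i, X i k = ⨆ F, T F := by
    refine le_antisymm (iSup_le fun k => ?_) (iSup_le hTle)
    refine le_trans ?_ (le_iSup T {k})
    refine le_trans ?_ (le_iSup _ k)
    simp
  refine condExp_eq_zero_of_isPiSystem (iSup_le hZm)
    (S := ⋃ F, {s | MeasurableSet[T F] s}) ?_ ?_ hui ?_ ?_
  · rw [hsup, MeasurableSpace.measurableSpace_iSup_eq]
    congr 1
    ext s
    simp
  · refine isPiSystem_iUnion_of_directed_le _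
      (fun F => @MeasurableSpace.isPiSystem_measurableSet _ (T F)) ?_
    exact Monotone.directed_le fun F G hFG s hs => hmono hFG s hs
  · simpa using h ∅ univ MeasurableSet.univ
  · intro s hs
    obtain ⟨F, hF⟩ := mem_iUnion.1 hs
    exact h F s hF

lemma measurableSet_iSup_iInf [Nonempty κ] (hXm : ∀ i k, X i k ≤ m)
    (hXc : ∀ i k, zeroLambda m P ≤ X i k) (hind : iIndep (fun k => ⨆ i, X i k) P)
    {A : Set Ω} (hA : ∀ i, MeasurableSet[⨆ k, X i k] A) :
    MeasurableSet[⨆ k, ⨅ i, X i k] A := by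
  set W : MeasurableSpace Ω := ⨆ k, ⨅ i, X i k with hW
  have i₀ : ι := Classical.arbitrary ι
  have k₀ : κ := Classical.arbitrary κ
  have hWV : ∀ i, W ≤ ⨆ k, X i k := fun i => iSup_mono fun k => iInf_le _ i
  have hVm : ∀ i, ⨆ k, X i k ≤ m := fun i => iSup_le fun k => hXm i k
  have hWm : W ≤ m := (hWV i₀).trans (hVm i₀)
  have hWc : zeroLambda m P ≤ W :=
    (le_iInf fun i => hXc i k₀).trans (le_iSup (fun k => ⨅ i, X i k) k₀)
  have hAm := hVm i₀ _ (hA i₀)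
  set g : Ω → ℝ := A.indicator fun _ => 1 with hg
  have hgi : Integrable g P := (integrable_const 1).indicator hAm
  have hui : Integrable (g - P[g | W]) P := hgi.sub integrable_condExp
  have hu : ∀ i, StronglyMeasurable[⨆ k, X i k] (g - P[g | W]) := fun i =>
    (stronglyMeasurable_const.indicator (hA i)).sub (stronglyMeasurable_condExp.mono (hWV i))
  have hw0 : P[g - P[g | W] | W] =ᵐ[P] 0 := by
    filter_upwards [condExp_sub hgi (integrable_condExp (m := W) (f := g)) W] with x hx
    rw [hx, condExp_of_stronglyMeasurable hWm stronglyMeasurable_condExp integrable_condExp]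
    simp
  have h := condExp_iSup_iSup_eq_zero hXm hXc hind hui hu hw0
  rw [condExp_of_stronglyMeasurable (iSup_le fun k => iSup_le fun i => hXm i k)
    ((hu i₀).mono (iSup_mono fun k => le_iSup (fun i => X i k) i₀)) hui] at h
  have hgW : AEStronglyMeasurable[W] g P := ⟨_, stronglyMeasurable_condExp, by
    filter_upwards [h] with x hx using sub_eq_zero.1 hx⟩
  have := measurable_of_aestronglyMeasurable hWm hWc
    (measurable_const.indicator hAm) hgW (measurableSet_singleton 1)
  convert this using 1
  ext x
  by_cases hx : x ∈ A <;> simp [hx]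

end Family

/-- **Distributivity I.** If the σ-fields `Z_β := ⋁_{α} X_{αβ}`, `β ∈ 𝔅`, form an
independent family, then `⋀_α ⋁_β X_{αβ} = ⋁_β ⋀_α X_{αβ}` (the join `⋁` of a family
being the σ-field generated by its union together with `0_Λ`). -/
theorem stmt5 {Ω : Type*} {m : MeasurableSpace Ω} (P : Measure Ω) [IsProbabilityMeasure P]
    {𝔄 𝔅 : Type*} [Nonempty 𝔄]
    (X : 𝔄 → 𝔅 → MeasurableSpace Ω)
    (hXm : ∀ α β, X α β ≤ m) (hXc : ∀ α β, zeroLambda m P ≤ X α β)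
    (hInd : iIndep (fun β : 𝔅 => (⨆ α : 𝔄, X α β) ⊔ zeroLambda m P) P) :
    ⨅ α : 𝔄, ((⨆ β : 𝔅, X α β) ⊔ zeroLambda m P)
      = (⨆ β : 𝔅, ⨅ α : 𝔄, X α β) ⊔ zeroLambda m P := by
  rcases isEmpty_or_nonempty 𝔅 with h𝔅 | h𝔅
  · simp
  have k₀ : 𝔅 := Classical.arbitrary 𝔅
  have i₀ : 𝔄 := Classical.arbitrary 𝔄
  have e1 : ∀ β, (⨆ α, X α β) ⊔ zeroLambda m P = ⨆ α, X α β := fun β =>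
    sup_eq_left.2 ((hXc i₀ β).trans (le_iSup (fun α => X α β) i₀))
  have e2 : ∀ α, (⨆ β, X α β) ⊔ zeroLambda m P = ⨆ β, X α β := fun α =>
    sup_eq_left.2 ((hXc α k₀).trans (le_iSup (X α) k₀))
  simp only [e1] at hInd
  simp only [e2]
  refine le_antisymm (fun A hA => ?_)
    (sup_le (le_iInf fun α => iSup_mono fun β => iInf_le _ α)
      (le_iInf fun α => (hXc α k₀).trans (le_iSup (X α) k₀)))
  exact (le_sup_left : _ ≤ (⨆ β, ⨅ α, X α β) ⊔ zeroLambda m P) _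
    (measurableSet_iSup_iInf hXm hXc hInd (MeasurableSpace.measurableSet_iInf.1 hA))
end

section
/- Let Y be a complete sub-σ-field of a probability space (Ω, M, P) and let (X_n)_{n ∈ ℕ} be a nonincreasing sequence of complete sub-σ-fields of M such that Y is independent of X_1 (hence of every X_n). Then ⋀_{n ∈ ℕ} (X_n ∨ Y) = (⋀_{n ∈ ℕ} X_n) ∨ Y. -/
open MeasureTheory ProbabilityTheory

namespace MeasureTheory

variable {Ω : Type*} {m : MeasurableSpace Ω} {P : Measure Ω}

/-- The intersections of members of two σ-algebras form a π-system generating their supremum. -/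
theorem sup_eq_generateFrom_inter (F G : MeasurableSpace Ω) :
    F ⊔ G = MeasurableSpace.generateFrom
      {S | ∃ D B, MeasurableSet[F] D ∧ MeasurableSet[G] B ∧ S = D ∩ B} := by
  refine le_antisymm (sup_le (fun D hD => ?_) (fun B hB => ?_))
    (MeasurableSpace.generateFrom_le ?_)
  · exact MeasurableSpace.measurableSet_generateFrom
      ⟨D, Set.univ, hD, MeasurableSet.univ, by simp⟩
  · exact MeasurableSpace.measurableSet_generateFrom
      ⟨Set.univ, B, MeasurableSet.univ, hB, by simp⟩
  · rintro S ⟨D, B, hD, hB, rfl⟩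
    exact MeasurableSet.inter ((le_sup_left : F ≤ F ⊔ G) D hD) ((le_sup_right : G ≤ F ⊔ G) B hB)

theorem isPiSystem_inter_measurableSet (F G : MeasurableSpace Ω) :
    IsPiSystem {S | ∃ D B, MeasurableSet[F] D ∧ MeasurableSet[G] B ∧ S = D ∩ B} := by
  rintro _ ⟨D, B, hD, hB, rfl⟩ _ ⟨D', B', hD', hB', rfl⟩ -
  exact ⟨D ∩ D', B ∩ B', hD.inter hD', hB.inter hB', Set.inter_inter_inter_comm D B D' B'⟩

/-- An integrable function whose integrals over all intersections of members of `F` and `G`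
vanish has zero conditional expectation given `F ⊔ G`. -/
theorem condExp_sup_ae_eq_zero [IsFiniteMeasure P] {F G : MeasurableSpace Ω}
    (hF : F ≤ m) (hG : G ≤ m) {v : Ω → ℝ} (hv : Integrable v P)
    (h : ∀ D B, MeasurableSet[F] D → MeasurableSet[G] B → ∫ x in D ∩ B, v x ∂P = 0) :
    P[v | F ⊔ G] =ᵐ[P] 0 := by
  have hFG : F ⊔ G ≤ m := sup_le hF hG
  have h_univ : ∫ x, v x ∂P = 0 := by
    simpa using h Set.univ Set.univ MeasurableSet.univ MeasurableSet.univ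
  have key : ∀ S, MeasurableSet[F ⊔ G] S → ∫ x in S, v x ∂P = 0 := by
    refine MeasurableSpace.induction_on_inter (sup_eq_generateFrom_inter F G)
      (isPiSystem_inter_measurableSet F G) (by simp) ?_ ?_ ?_
    · rintro _ ⟨D, B, hD, hB, rfl⟩
      exact h D B hD hB
    · intro S hS hS0
      have := integral_add_compl (hFG S hS) hv
      linarith
    · intro f hd hf h0
      rw [integral_iUnion (fun i => hFG _ (hf i)) hd hv.integrableOn]
      simp [h0]
  refine (ae_eq_condExp_of_forall_setIntegral_eq hFG hv (fun _ _ _ => integrableOn_zero)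
    (fun S hS _ => ?_) aestronglyMeasurable_zero).symm
  simp [key S hS]

/-- If `Y` is independent of `H ≥ F`, then for an `H`-measurable function conditioning on
`F ⊔ Y` amounts to conditioning on `F`. -/
theorem condExp_sup_ae_eq_of_indep [IsProbabilityMeasure P] {F H Y : MeasurableSpace Ω}
    (hFH : F ≤ H) (hH : H ≤ m) (hY : Y ≤ m) (hInd : Indep Y H P) {u : Ω → ℝ}
    (hu : StronglyMeasurable[H] u) (hui : Integrable u P) :
    P[u | F ⊔ Y] =ᵐ[P] P[u | F] := by
  have hF : F ≤ m := hFH.trans hH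
  have hcm : StronglyMeasurable[F] (P[u | F]) := stronglyMeasurable_condExp
  have hvi : Integrable (u - P[u | F]) P := hui.sub integrable_condExp
  have hvm : StronglyMeasurable[H] (u - P[u | F]) := hu.sub (hcm.mono hFH)
  have hzero : P[u - P[u | F] | F ⊔ Y] =ᵐ[P] 0 := by
    refine condExp_sup_ae_eq_zero hF hY hvi fun D B hD hB => ?_
    have hint : ∫ x, D.indicator (u - P[u | F]) x ∂P = 0 := by
      rw [integral_indicator (hF D hD)]
      simp only [Pi.sub_apply]
      rw [integral_sub hui.integrableOn integrable_condExp.integrableOn,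
        setIntegral_condExp hF hui hD, sub_self]
    have hindep := condExp_indep_eq hH hY (hvm.indicator (hFH D hD)) hInd.symm
    rw [Set.inter_comm, ← setIntegral_indicator (hF D hD),
      ← setIntegral_condExp hY (hvi.indicator (hF D hD)) hB,
      setIntegral_congr_ae (hY B hB) (hindep.mono fun x hx _ => hx)]
    simp [hint]
  have hsub := condExp_sub hui integrable_condExp (F ⊔ Y) (g := P[u | F])
  have hself : P[P[u | F] | F ⊔ Y] = P[u | F] :=
    condExp_of_stronglyMeasurable (sup_le hF hY) (hcm.mono le_sup_left) integrable_condExp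
  filter_upwards [hzero, hsub] with x hx hx'
  rw [hx, Pi.sub_apply, hself] at hx'
  exact (sub_eq_zero.mp hx'.symm)

/-- Conditional expectation is self-adjoint. -/
theorem integral_mul_condExp_comm [IsFiniteMeasure P] {F : MeasurableSpace Ω} (hF : F ≤ m)
    {h g : Ω → ℝ} (hh : Integrable h P) (hg : Integrable g P) {c : ℝ}
    (hc : ∀ᵐ x ∂P, |g x| ≤ c) :
    ∫ x, h x * (P[g | F]) x ∂P = ∫ x, (P[h | F]) x * g x ∂P := by
  have hc' : ∀ᵐ x ∂P, |(P[g | F]) x| ≤ c := ae_bdd_abs_condExp_of_ae_bdd_abs hc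
  have hleft : Integrable (h * P[g | F]) P :=
    hh.mul_bdd integrable_condExp.aestronglyMeasurable hc'
  have hright : Integrable (P[h | F] * g) P :=
    Integrable.mul_bdd integrable_condExp hg.aestronglyMeasurable hc
  have e₁ := condExp_mul_of_stronglyMeasurable_right
    (stronglyMeasurable_condExp (m := F) (f := g) (μ := P)) hleft hh
  have e₂ := condExp_mul_of_stronglyMeasurable_left
    (stronglyMeasurable_condExp (m := F) (f := h) (μ := P)) hright hg
  calc ∫ x, (h * P[g | F]) x ∂P = ∫ x, (P[h * P[g | F] | F]) x ∂P := (integral_condExp hF).symm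
    _ = ∫ x, (P[P[h | F] * g | F]) x ∂P := integral_congr_ae (e₁.trans e₂.symm)
    _ = ∫ x, (P[h | F] * g) x ∂P := integral_condExp hF

/-- If `Y` is independent of `H ≥ F`, then for an `F ⊔ Y`-measurable function conditioning on
`H` amounts to conditioning on `F`. -/
theorem condExp_ae_eq_of_stronglyMeasurable_sup_indep [IsProbabilityMeasure P]
    {F H Y : MeasurableSpace Ω} (hFH : F ≤ H) (hH : H ≤ m) (hY : Y ≤ m) (hInd : Indep Y H P)
    {h : Ω → ℝ} (hm : StronglyMeasurable[F ⊔ Y] h) (hh : Integrable h P) :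
    P[h | H] =ᵐ[P] P[h | F] := by
  have hF : F ≤ m := hFH.trans hH
  refine (ae_eq_condExp_of_forall_setIntegral_eq hH hh
    (fun _ _ _ => integrable_condExp.integrableOn) (fun A hA _ => ?_)
    (stronglyMeasurable_condExp.mono hFH).aestronglyMeasurable).symm
  let g : Ω → ℝ := A.indicator fun _ => 1
  have hgm : StronglyMeasurable[H] g := stronglyMeasurable_const.indicator hA
  have hg : Integrable g P := (integrable_const 1).indicator (hH A hA)
  have hc : ∀ᵐ x ∂P, |g x| ≤ 1 := .of_forall fun x => by
    by_cases hx : x ∈ A <;> simp [g, hx]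
  have hmul : ∀ f : Ω → ℝ, ∫ x in A, f x ∂P = ∫ x, f x * g x ∂P := fun f => by
    rw [← integral_indicator (hH A hA)]
    refine integral_congr_ae (.of_forall fun x => ?_)
    by_cases hx : x ∈ A <;> simp [g, hx]
  rw [hmul, hmul, ← integral_mul_condExp_comm hF hh hg hc]
  have hsup := condExp_sup_ae_eq_of_indep hFH hH hY hInd hgm hg
  calc ∫ x, h x * (P[g | F]) x ∂P = ∫ x, h x * (P[g | F ⊔ Y]) x ∂P :=
        integral_congr_ae (hsup.mono fun x hx => by simp only [hx])
    _ = ∫ x, (P[h | F ⊔ Y]) x * g x ∂P :=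
        integral_mul_condExp_comm (sup_le hF hY) hh hg hc
    _ = ∫ x, h x * g x ∂P := by
        rw [condExp_of_stronglyMeasurable (sup_le hF hY) hm hh]

end MeasureTheory

section Completeness

variable {Ω : Type*} {m : MeasurableSpace Ω} {P : Measure Ω}

theorem measurableSet_of_zeroLambda_le {F : MeasurableSpace Ω} (hc : zeroLambda m P ≤ F)
    {A : Set Ω} (hA : MeasurableSet[m] A) (h0 : P A = 0) : MeasurableSet[F] A :=
  hc A (MeasurableSpace.measurableSet_generateFrom ⟨hA, Or.inl h0⟩)

/-- A set which is a.e. equal to a member of a complete sub-σ-algebra belongs to it. -/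
theorem measurableSet_of_ae_eq_of_zeroLambda_le {F : MeasurableSpace Ω} (hF : F ≤ m)
    (hc : zeroLambda m P ≤ F) {A B : Set Ω} (hA : MeasurableSet[m] A) (hB : MeasurableSet[F] B)
    (hAB : A =ᵐ[P] B) : MeasurableSet[F] A := by
  obtain ⟨h₁, h₂⟩ := ae_eq_set.mp hAB
  have hA' : A = (B \ (B \ A)) ∪ (A \ B) := by
    ext x
    simp only [Set.mem_union, Set.mem_sdiff]
    tauto
  rw [hA']
  exact (hB.diff (measurableSet_of_zeroLambda_le hc ((hF B hB).diff hA) h₂)).union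
    (measurableSet_of_zeroLambda_le hc (hA.diff (hF B hB)) h₁)

/-- A measurable function which is a.e. equal to a function measurable with respect to a complete
sub-σ-algebra is itself measurable with respect to it. -/
theorem measurable_of_ae_eq_of_zeroLambda_le_s6 {E : Type*} [MeasurableSpace E]
    {F : MeasurableSpace Ω} (hF : F ≤ m)
    (hc : zeroLambda m P ≤ F) {f g : Ω → E} (hf : Measurable[m] f) (hg : Measurable[F] g)
    (hfg : f =ᵐ[P] g) : Measurable[F] f := fun s hs =>
  measurableSet_of_ae_eq_of_zeroLambda_le hF hc (hf hs) (hg hs) (hfg.preimage s)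

end Completeness

/-- **Distributivity II (i).** If `Y` is independent of a nonincreasing sequence
`(X_n)` of complete sub-σ-fields, then `⋀_n (X_n ∨ Y) = (⋀_n X_n) ∨ Y`. -/
theorem stmt6 {Ω : Type*} {m : MeasurableSpace Ω} (P : Measure Ω) [IsProbabilityMeasure P]
    (Y : MeasurableSpace Ω) (hYm : Y ≤ m) (hYc : zeroLambda m P ≤ Y)
    (X : ℕ → MeasurableSpace Ω) (hXm : ∀ n, X n ≤ m) (hXc : ∀ n, zeroLambda m P ≤ X n)
    (hanti : ∀ i j : ℕ, i ≤ j → X j ≤ X i)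
    (hInd : Indep Y (X 0) P) :
    ⨅ n : ℕ, (X n ⊔ Y) = (⨅ n : ℕ, X n) ⊔ Y := by
  refine le_antisymm (fun C hC => ?_)
    (le_iInf fun n => sup_le_sup_right (iInf_le X n) Y)
  have hI : (⨅ n, X n) ≤ m := (iInf_le X 0).trans (hXm 0)
  set W := (⨅ n, X n) ⊔ Y
  have hW : W ≤ m := sup_le hI hYm
  have hWZ : ∀ n, W ≤ X n ⊔ Y := fun n => sup_le_sup_right (iInf_le X n) Y
  have hWc : zeroLambda m P ≤ W := hYc.trans le_sup_right
  have hZ : ∀ n, X n ⊔ Y ≤ m := fun n => sup_le (hXm n) hYm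
  have hCZ : ∀ n, MeasurableSet[X n ⊔ Y] C := fun n => iInf_le (fun n => X n ⊔ Y) n C hC
  have hCm : MeasurableSet[m] C := hZ 0 C (hCZ 0)
  let f : Ω → ℝ := C.indicator fun _ => 1
  have hf : Integrable f P := (integrable_const 1).indicator hCm
  let h : Ω → ℝ := f - P[f | W]
  have hh : Integrable h P := hf.sub integrable_condExp
  have hhm : ∀ n, StronglyMeasurable[X n ⊔ Y] h := fun n =>
    (stronglyMeasurable_const.indicator (hCZ n)).sub (stronglyMeasurable_condExp.mono (hWZ n))
  have hhW : ∀ S, MeasurableSet[W] S → ∫ x in S, h x ∂P = 0 := fun S hS => by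
    simp only [h, Pi.sub_apply]
    rw [integral_sub hf.integrableOn integrable_condExp.integrableOn,
      setIntegral_condExp hW hf hS, sub_self]
  have hcond : ∀ B, MeasurableSet[Y] B → P[B.indicator h | X 0] =ᵐ[P] 0 := fun B hB => by
    have hBi : Integrable (B.indicator h) P := hh.indicator (hYm B hB)
    have hmeas : ∀ n, Measurable[X n] (P[B.indicator h | X 0]) := fun n =>
      measurable_of_ae_eq_of_zeroLambda_le_s6 (hXm n) (hXc n)
        (stronglyMeasurable_condExp.mono (hXm 0)).measurable
        stronglyMeasurable_condExp.measurable
        (condExp_ae_eq_of_stronglyMeasurable_sup_indep (hanti 0 n n.zero_le) (hXm 0) hYm hInd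
          ((hhm n).indicator ((le_sup_right : Y ≤ X n ⊔ Y) B hB)) hBi)
    have hmeasI : Measurable[⨅ n, X n] (P[B.indicator h | X 0]) := fun s hs =>
      MeasurableSpace.measurableSet_iInf.mpr fun n => hmeas n hs
    refine ae_eq_of_forall_setIntegral_eq_of_sigmaFinite' hI
      (fun _ _ _ => integrable_condExp.integrableOn) (fun _ _ _ => integrableOn_zero)
      (fun D hD _ => ?_) hmeasI.stronglyMeasurable.aestronglyMeasurable
      aestronglyMeasurable_zero
    rw [setIntegral_condExp (hXm 0) hBi (iInf_le X 0 D hD), setIntegral_indicator (hYm B hB),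
      hhW (D ∩ B) (MeasurableSet.inter ((le_sup_left : (⨅ n, X n) ≤ W) D hD)
        ((le_sup_right : Y ≤ W) B hB))]
    simp
  have hh0 : h =ᵐ[P] 0 := by
    have := condExp_sup_ae_eq_zero (hXm 0) hYm hh fun A B hA hB => by
      rw [← setIntegral_indicator (hYm B hB),
        ← setIntegral_condExp (hXm 0) (hh.indicator (hYm B hB)) hA,
        setIntegral_congr_ae (hXm 0 A hA) ((hcond B hB).mono fun x hx _ => hx)]
      simp
    rwa [condExp_of_stronglyMeasurable (hZ 0) (hhm 0) hh] at this
  have hfW : Measurable[W] f :=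
    measurable_of_ae_eq_of_zeroLambda_le_s6 hW hWc
      ((measurable_const (a := (1 : ℝ))).indicator hCm)
      stronglyMeasurable_condExp.measurable (hh0.mono fun x hx => sub_eq_zero.mp hx)
  have hCf : C = f ⁻¹' {1} := by
    ext x
    by_cases hx : x ∈ C <;> simp [f, hx]
  rw [hCf]
  exact hfW (measurableSet_singleton 1)
end

section
/- Let X₁, X₂, Y₁, Y₂ be complete sub-σ-fields of a probability space (Ω, M, P). If X₁ ∨ X₂ is independent of Y₁ ∨ Y₂, then (X₁ ∨ Y₁) ∧ (X₂ ∨ Y₂) = (X₁ ∧ X₂) ∨ (Y₁ ∧ Y₂). In particular, for complete sub-σ-fields X, A, Y with X ⊆ A and A independent of Y, one has (X ∨ Y) ∧ A = X. -/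
open MeasureTheory ProbabilityTheory

/-- A function that is a.e. equal to a `k`-measurable function is `k`-measurable as soon as `k`
contains the trivial events. -/
lemma measurable_of_ae_eq_of_zeroLambda_le_s7 {Ω β : Type*} [MeasurableSpace β]
    {k m : MeasurableSpace Ω} {P : Measure Ω} [IsProbabilityMeasure P] (hk : k ≤ m)
    (h0 : zeroLambda m P ≤ k) {u v : Ω → β} (hu : Measurable[m] u) (hv : Measurable[k] v)
    (huv : u =ᵐ[P] v) : Measurable[k] u := by
  have hnull {N : Set Ω} (hN : MeasurableSet[m] N) (hN0 : P N = 0) : MeasurableSet[k] N :=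
    h0 _ (MeasurableSpace.measurableSet_generateFrom ⟨hN, Or.inl hN0⟩)
  intro S hS
  have hu' : MeasurableSet[m] (u ⁻¹' S) := hu hS
  have hv' : MeasurableSet[k] (v ⁻¹' S) := hv hS
  have hne : P {x | ¬ u x = v x} = 0 := huv
  have h1 : MeasurableSet[k] (u ⁻¹' S \ v ⁻¹' S) :=
    hnull (hu'.diff (hk _ hv')) (measure_mono_null (t := {x | ¬ u x = v x}) (fun x hx h => hx.2 (by
      simpa only [Set.mem_preimage, h] using hx.1)) hne)
  have h2 : MeasurableSet[k] (v ⁻¹' S \ u ⁻¹' S) :=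
    hnull ((hk _ hv').diff hu') (measure_mono_null (t := {x | ¬ u x = v x}) (fun x hx h => hx.2 (by
      simpa only [Set.mem_preimage, h] using hx.1)) hne)
  have h3 : u ⁻¹' S = (v ⁻¹' S \ (v ⁻¹' S \ u ⁻¹' S)) ∪ (u ⁻¹' S \ v ⁻¹' S) := by
    ext x
    simp only [Set.mem_union, Set.mem_sdiff]
    tauto
  rw [h3]
  exact (hv'.diff h2).union h1

lemma measurable_indicator_one {Ω : Type*} {k : MeasurableSpace Ω} {B : Set Ω}
    (hB : MeasurableSet B) : Measurable (B.indicator (1 : Ω → ℝ)) :=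
  measurable_one.indicator hB

/-- The conditional expectation given `M₁ ⊔ M₂` vanishes if all integrals over intersections of
an `M₁`-event and an `M₂`-event do. -/
lemma condExp_sup_eq_zero_s7 {Ω : Type*} {M₁ M₂ m : MeasurableSpace Ω} {P : Measure Ω}
    [IsProbabilityMeasure P] (h₁ : M₁ ≤ m) (h₂ : M₂ ≤ m) {u : Ω → ℝ} (hu : Integrable u P)
    (h : ∀ B C, MeasurableSet[M₁] B → MeasurableSet[M₂] C → ∫ x in B ∩ C, u x ∂P = 0) :
    P[u | M₁ ⊔ M₂] =ᵐ[P] 0 := by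
  have hle : M₁ ⊔ M₂ ≤ m := sup_le h₁ h₂
  let S : Set (Set Ω) := {A | ∃ B C, MeasurableSet[M₁] B ∧ MeasurableSet[M₂] C ∧ A = B ∩ C}
  have hS : IsPiSystem S := by
    rintro _ ⟨B, C, hB, hC, rfl⟩ _ ⟨B', C', hB', hC', rfl⟩ _
    exact ⟨B ∩ B', C ∩ C', hB.inter hB', hC.inter hC', Set.inter_inter_inter_comm ..⟩
  have hgen : M₁ ⊔ M₂ = MeasurableSpace.generateFrom S := by
    refine le_antisymm (sup_le (fun B hB => ?_) fun C hC => ?_) ?_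
    · exact .basic _ ⟨B, Set.univ, hB, .univ, by simp⟩
    · exact .basic _ ⟨Set.univ, C, .univ, hC, by simp⟩
    · refine MeasurableSpace.generateFrom_le ?_
      rintro _ ⟨B, C, hB, hC, rfl⟩
      exact (le_sup_left (a := M₁) (b := M₂) _ hB).inter (le_sup_right (a := M₁) (b := M₂) _ hC)
  have huniv : ∫ x, u x ∂P = 0 := by
    simpa using h Set.univ Set.univ .univ .univ
  have key : ∀ A, MeasurableSet[M₁ ⊔ M₂] A → ∫ x in A, u x ∂P = 0 := by
    refine MeasurableSpace.induction_on_inter (C := fun A _ => ∫ x in A, u x ∂P = 0) hgen hS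
      (by simp) ?_ ?_ ?_
    · rintro _ ⟨B, C, hB, hC, rfl⟩
      exact h B C hB hC
    · intro A hA hA0
      have := integral_add_compl (hle _ hA) hu
      linarith
    · intro f hd hf hf0
      rw [integral_iUnion (fun i => hle _ (hf i)) hd hu.integrableOn]
      simp [hf0]
  refine (ae_eq_condExp_of_forall_setIntegral_eq hle hu (fun _ _ _ => integrableOn_zero)
    (fun A hA _ => ?_) aestronglyMeasurable_zero).symm
  simp [key A hA]

/-- Conditional expectation is self-adjoint. -/
lemma integral_condExp_mul_comm {Ω : Type*} {k m : MeasurableSpace Ω} {P : Measure Ω}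
    [IsProbabilityMeasure P] (hk : k ≤ m) {u v : Ω → ℝ} (hu : MemLp u ⊤ P) (hv : MemLp v ⊤ P) :
    ∫ x, P[u | k] x * v x ∂P = ∫ x, u x * P[v | k] x ∂P := by
  have hu' : MemLp (P[u | k]) ⊤ P := hu.condExp le_top
  have hv' : MemLp (P[v | k]) ⊤ P := hv.condExp le_top
  have h1 : P[P[u | k] * v | k] =ᵐ[P] P[u | k] * P[v | k] :=
    condExp_mul_of_stronglyMeasurable_left stronglyMeasurable_condExp
      ((hv.mul hu' (r := ⊤)).integrable le_top) (hv.integrable le_top)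
  have h2 : P[u * P[v | k] | k] =ᵐ[P] P[u | k] * P[v | k] :=
    condExp_mul_of_stronglyMeasurable_right stronglyMeasurable_condExp
      ((hv'.mul hu (r := ⊤)).integrable le_top) (hu.integrable le_top)
  calc ∫ x, P[u | k] x * v x ∂P = ∫ x, P[P[u | k] * v | k] x ∂P := (integral_condExp hk).symm
    _ = ∫ x, P[u * P[v | k] | k] x ∂P := integral_congr_ae (h1.trans h2.symm)
    _ = ∫ x, u x * P[v | k] x ∂P := integral_condExp hk

/-- If `X ⟂ Y`, `f` is `X`-measurable and `g` is `Y`-measurable with `E[g | Y₁] = 0`, then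
`E[f g | X₁ ∨ Y₁] = 0`. -/
lemma condExp_sup_mul_eq_zero_of_indep {Ω : Type*} {X Y X₁ Y₁ m : MeasurableSpace Ω}
    {P : Measure Ω} [IsProbabilityMeasure P] (hX : X ≤ m) (hY : Y ≤ m) (hX₁ : X₁ ≤ X)
    (hY₁ : Y₁ ≤ Y) (hind : Indep X Y P) {f g : Ω → ℝ} (hf : Measurable[X] f)
    (hg : Measurable[Y] g) (hfb : MemLp f ⊤ P) (hgb : MemLp g ⊤ P) (hg0 : P[g | Y₁] =ᵐ[P] 0) :
    P[f * g | X₁ ⊔ Y₁] =ᵐ[P] 0 := by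
  refine condExp_sup_eq_zero_s7 (hX₁.trans hX) (hY₁.trans hY)
    ((hgb.mul hfb (r := ⊤)).integrable le_top) fun B C hB hC => ?_
  have hfB : Measurable[X] (B.indicator f) := hf.indicator (hX₁ _ hB)
  have hgC : Measurable[Y] (C.indicator g) := hg.indicator (hY₁ _ hC)
  have hIF : IndepFun (B.indicator f) (C.indicator g) P :=
    indep_of_indep_of_le_left (indep_of_indep_of_le_right hind hgC.comap_le) hfB.comap_le
  have hBC : (B ∩ C).indicator (f * g) = B.indicator f * C.indicator g := by
    ext x
    by_cases h1 : x ∈ B <;> by_cases h2 : x ∈ C <;> simp [h1, h2]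
  have hC0 : ∫ x, C.indicator g x ∂P = 0 := by
    rw [integral_indicator (hY _ (hY₁ _ hC)),
      ← setIntegral_condExp (hY₁.trans hY) (hgb.integrable le_top) hC,
      integral_congr_ae (ae_restrict_of_ae hg0)]
    simp
  rw [← integral_indicator ((hX _ (hX₁ _ hB)).inter (hY _ (hY₁ _ hC))), hBC,
    hIF.integral_mul_eq_mul_integral (hfB.mono hX le_rfl).aestronglyMeasurable
      (hgC.mono hY le_rfl).aestronglyMeasurable, hC0, mul_zero]

/-- If `X ⟂ Y`, `φ` is `X₁ ∨ Y₁`-measurable and `f` is `X`-measurable, then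
`E[φ f | Y] = E[φ f | Y₁]`. -/
lemma condExp_mul_ae_eq_of_indep {Ω : Type*} {X Y X₁ Y₁ m : MeasurableSpace Ω}
    {P : Measure Ω} [IsProbabilityMeasure P] (hX : X ≤ m) (hY : Y ≤ m) (hX₁ : X₁ ≤ X)
    (hY₁ : Y₁ ≤ Y) (hind : Indep X Y P) {φ f : Ω → ℝ} (hφ : Measurable[X₁ ⊔ Y₁] φ)
    (hf : Measurable[X] f) (hφb : MemLp φ ⊤ P) (hfb : MemLp f ⊤ P) :
    P[φ * f | Y] =ᵐ[P] P[φ * f | Y₁] := by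
  have hY₁m : Y₁ ≤ m := hY₁.trans hY
  have hle : X₁ ⊔ Y₁ ≤ m := sup_le (hX₁.trans hX) hY₁m
  have hφf : MemLp (φ * f) ⊤ P := hfb.mul hφb
  refine (ae_eq_condExp_of_forall_setIntegral_eq hY (hφf.integrable le_top)
    (fun _ _ _ => integrable_condExp.integrableOn) (fun C hC _ => ?_)
    (stronglyMeasurable_condExp.mono hY₁).aestronglyMeasurable).symm
  set c : Ω → ℝ := C.indicator 1 with hc
  have hcm : Measurable[Y] c := measurable_indicator_one hC
  have hcb : MemLp c ⊤ P := memLp_indicator_const ⊤ (hY _ hC) 1 (Or.inr (measure_ne_top _ _))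
  have hcb' : MemLp (P[c | Y₁]) ⊤ P := hcb.condExp le_top
  have hset (u : Ω → ℝ) : ∫ x in C, u x ∂P = ∫ x, u x * c x ∂P := by
    rw [← integral_indicator (hY _ hC)]
    congr 1 with x
    by_cases h : x ∈ C <;> simp [hc, h]
  have hg0 : P[c - P[c | Y₁] | Y₁] =ᵐ[P] 0 := by
    filter_upwards [condExp_sub (hcb.integrable le_top) (hcb'.integrable le_top) Y₁] with x hx
    rw [hx, condExp_of_stronglyMeasurable hY₁m stronglyMeasurable_condExp integrable_condExp]
    simp
  have hfg := condExp_sup_mul_eq_zero_of_indep hX hY hX₁ hY₁ hind hf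
    (hcm.sub (stronglyMeasurable_condExp.measurable.mono hY₁ le_rfl)) hfb (hcb.sub hcb') hg0
  have hfgb : MemLp (f * (c - P[c | Y₁])) ⊤ P := (hcb.sub hcb').mul hfb
  have hzero : ∫ x, φ x * (f * (c - P[c | Y₁])) x ∂P = 0 := by
    have h1 := integral_condExp_mul_comm hle hφb hfgb
    rw [condExp_of_stronglyMeasurable hle hφ.stronglyMeasurable (hφb.integrable le_top)] at h1
    rw [h1]
    refine integral_eq_zero_of_ae ?_
    filter_upwards [hfg] with x hx
    simp [hx]
  have hsub : ∫ x, (φ * f) x * c x ∂P - ∫ x, (φ * f) x * P[c | Y₁] x ∂P = 0 := by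
    have hi : Integrable (fun x => (φ * f) x * c x) P :=
      (hcb.mul hφf (r := ⊤)).integrable le_top
    have hi' : Integrable (fun x => (φ * f) x * P[c | Y₁] x) P :=
      (hcb'.mul hφf (r := ⊤)).integrable le_top
    rw [← integral_sub hi hi', ← hzero]
    congr 1 with x
    simp only [Pi.mul_apply, Pi.sub_apply]
    ring
  rw [hset, hset, integral_condExp_mul_comm hY₁m hφf hcb]
  linarith

/-- If `X₁ ∨ X₂ ≤ X ⟂ Y ≥ Y₁ ∨ Y₂` and `φ` is measurable for both `X₁ ∨ Y₁` and `X₂ ∨ Y₂`, then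
in integrals of `φ f g`, with `f` and `g` measurable for `X` and `Y`, the factor `g` may be
replaced by `E[g | Y₁ ∧ Y₂]`. -/
lemma integral_mul_condExp_inf_of_indep {Ω : Type*} {X Y X₁ X₂ Y₁ Y₂ m : MeasurableSpace Ω}
    {P : Measure Ω} [IsProbabilityMeasure P] (hX : X ≤ m) (hY : Y ≤ m) (hX₁ : X₁ ≤ X)
    (hX₂ : X₂ ≤ X) (hY₁ : Y₁ ≤ Y) (hY₂ : Y₂ ≤ Y) (h0 : zeroLambda m P ≤ Y₂)
    (hind : Indep X Y P) {φ f g : Ω → ℝ} (hφ₁ : Measurable[X₁ ⊔ Y₁] φ)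
    (hφ₂ : Measurable[X₂ ⊔ Y₂] φ) (hf : Measurable[X] f) (hg : Measurable[Y] g)
    (hφb : MemLp φ ⊤ P) (hfb : MemLp f ⊤ P) (hgb : MemLp g ⊤ P) :
    ∫ x, (φ * f) x * g x ∂P = ∫ x, (φ * f) x * P[g | Y₁ ⊓ Y₂] x ∂P := by
  have hφf : MemLp (φ * f) ⊤ P := hfb.mul hφb
  have hY₁m : Y₁ ≤ m := hY₁.trans hY
  have hle : Y₁ ⊓ Y₂ ≤ m := inf_le_left.trans hY₁m
  have e₁ := condExp_mul_ae_eq_of_indep hX hY hX₁ hY₁ hind hφ₁ hf hφb hfb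
  have e₂ := condExp_mul_ae_eq_of_indep hX hY hX₂ hY₂ hind hφ₂ hf hφb hfb
  have hm₁ : Measurable[Y₁] (P[φ * f | Y₁]) := stronglyMeasurable_condExp.measurable
  have hm₂ : Measurable[Y₂] (P[φ * f | Y₁]) :=
    measurable_of_ae_eq_of_zeroLambda_le_s7 (hY₂.trans hY) h0 (hm₁.mono hY₁m le_rfl)
      stronglyMeasurable_condExp.measurable (e₁.symm.trans e₂)
  have hm : Measurable[Y₁ ⊓ Y₂] (P[φ * f | Y₁]) := fun S hS => ⟨hm₁ hS, hm₂ hS⟩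
  have hself : P[P[φ * f | Y₁] | Y₁ ⊓ Y₂] = P[φ * f | Y₁] :=
    condExp_of_stronglyMeasurable hle hm.stronglyMeasurable integrable_condExp
  have htower : P[P[φ * f | Y₁] | Y₁ ⊓ Y₂] =ᵐ[P] P[φ * f | Y₁ ⊓ Y₂] :=
    condExp_condExp_of_le inf_le_left hY₁m
  rw [hself] at htower
  have hgY : P[g | Y] = g :=
    condExp_of_stronglyMeasurable hY hg.stronglyMeasurable (hgb.integrable le_top)
  calc ∫ x, (φ * f) x * g x ∂P = ∫ x, (φ * f) x * P[g | Y] x ∂P := by rw [hgY]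
    _ = ∫ x, P[φ * f | Y] x * g x ∂P := (integral_condExp_mul_comm hY hφf hgb).symm
    _ = ∫ x, P[φ * f | Y₁ ⊓ Y₂] x * g x ∂P := by
      refine integral_congr_ae ?_
      filter_upwards [e₁.trans htower] with x hx
      rw [hx]
    _ = _ := integral_condExp_mul_comm hle hφf hgb

/-- Under the independence assumption, a bounded function which is measurable for both `X₁ ∨ Y₁`
and `X₂ ∨ Y₂` and is centred given `(X₁ ∧ X₂) ∨ (Y₁ ∧ Y₂)` vanishes almost surely. -/
lemma ae_eq_zero_of_condExp_inf_sup_inf_eq_zero {Ω : Type*}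
    {X₁ X₂ Y₁ Y₂ m : MeasurableSpace Ω} {P : Measure Ω} [IsProbabilityMeasure P]
    (hX₁ : X₁ ≤ m) (hX₂ : X₂ ≤ m) (hY₁ : Y₁ ≤ m) (hY₂ : Y₂ ≤ m)
    (hX0 : zeroLambda m P ≤ X₂) (hY0 : zeroLambda m P ≤ Y₂)
    (hind : Indep (X₁ ⊔ X₂) (Y₁ ⊔ Y₂) P) {φ : Ω → ℝ} (hφ₁ : Measurable[X₁ ⊔ Y₁] φ)
    (hφ₂ : Measurable[X₂ ⊔ Y₂] φ) (hφb : MemLp φ ⊤ P)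
    (hφ0 : P[φ | (X₁ ⊓ X₂) ⊔ (Y₁ ⊓ Y₂)] =ᵐ[P] 0) : φ =ᵐ[P] 0 := by
  have hX : X₁ ⊔ X₂ ≤ m := sup_le hX₁ hX₂
  have hY : Y₁ ⊔ Y₂ ≤ m := sup_le hY₁ hY₂
  have hXi : X₁ ⊓ X₂ ≤ m := inf_le_left.trans hX₁
  have hYi : Y₁ ⊓ Y₂ ≤ m := inf_le_left.trans hY₁
  have hW : (X₁ ⊓ X₂) ⊔ (Y₁ ⊓ Y₂) ≤ m := sup_le hXi hYi
  have hφX : Measurable[(X₁ ⊔ X₂) ⊔ (Y₁ ⊔ Y₂)] φ :=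
    hφ₁.mono (sup_le_sup le_sup_left le_sup_left) le_rfl
  have hself : P[φ | (X₁ ⊔ X₂) ⊔ (Y₁ ⊔ Y₂)] = φ :=
    condExp_of_stronglyMeasurable (sup_le hX hY) hφX.stronglyMeasurable (hφb.integrable le_top)
  rw [← hself]
  refine condExp_sup_eq_zero_s7 hX hY (hφb.integrable le_top) fun B C hB hC => ?_
  set b : Ω → ℝ := B.indicator 1 with hb
  set c : Ω → ℝ := C.indicator 1 with hc
  have hbm : Measurable[X₁ ⊔ X₂] b := measurable_indicator_one hB
  have hcm : Measurable[Y₁ ⊔ Y₂] c := measurable_indicator_one hC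
  have hbb : MemLp b ⊤ P := memLp_indicator_const ⊤ (hX _ hB) 1 (Or.inr (measure_ne_top _ _))
  have hcb : MemLp c ⊤ P := memLp_indicator_const ⊤ (hY _ hC) 1 (Or.inr (measure_ne_top _ _))
  set b' : Ω → ℝ := P[b | X₁ ⊓ X₂]
  set c' : Ω → ℝ := P[c | Y₁ ⊓ Y₂]
  have hbm' : Measurable[X₁ ⊓ X₂] b' := stronglyMeasurable_condExp.measurable
  have hcm' : Measurable[Y₁ ⊓ Y₂] c' := stronglyMeasurable_condExp.measurable
  have hbb' : MemLp b' ⊤ P := hbb.condExp le_top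
  have hcb' : MemLp c' ⊤ P := hcb.condExp le_top
  have hbc' : MemLp (b' * c') ⊤ P := hcb'.mul hbb'
  have hstepX : ∫ x, (φ * c) x * b x ∂P = ∫ x, (φ * c) x * b' x ∂P :=
    integral_mul_condExp_inf_of_indep hY hX le_sup_left le_sup_right le_sup_left le_sup_right
      hX0 hind.symm (by rwa [sup_comm]) (by rwa [sup_comm]) hcm hbm hφb hcb hbb
  have hstepY : ∫ x, (φ * b') x * c x ∂P = ∫ x, (φ * b') x * c' x ∂P :=
    integral_mul_condExp_inf_of_indep hX hY le_sup_left le_sup_right le_sup_left le_sup_right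
      hY0 hind hφ₁ hφ₂ (hbm'.mono (inf_le_left.trans le_sup_left) le_rfl) hcm hφb hbb' hcb
  have hbcm' : Measurable[(X₁ ⊓ X₂) ⊔ (Y₁ ⊓ Y₂)] (b' * c') :=
    (hbm'.mono le_sup_left le_rfl).mul (hcm'.mono le_sup_right le_rfl)
  calc ∫ x in B ∩ C, φ x ∂P = ∫ x, (φ * c) x * b x ∂P := by
        rw [← integral_indicator ((hX _ hB).inter (hY _ hC))]
        congr 1 with x
        by_cases h1 : x ∈ B <;> by_cases h2 : x ∈ C <;> simp [hb, hc, h1, h2]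
    _ = ∫ x, (φ * b') x * c x ∂P := by
        rw [hstepX]
        congr 1 with x
        simp only [Pi.mul_apply]
        ring
    _ = ∫ x, φ x * P[b' * c' | (X₁ ⊓ X₂) ⊔ (Y₁ ⊓ Y₂)] x ∂P := by
        rw [hstepY, condExp_of_stronglyMeasurable hW hbcm'.stronglyMeasurable
          (hbc'.integrable le_top)]
        congr 1 with x
        simp only [Pi.mul_apply]
        ring
    _ = 0 := by
        rw [← integral_condExp_mul_comm hW hφb hbc']
        refine integral_eq_zero_of_ae ?_
        filter_upwards [hφ0] with x hx
        simp [hx]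

lemma sup_inf_sup_eq_of_indep {Ω : Type*} {X₁ X₂ Y₁ Y₂ m : MeasurableSpace Ω} {P : Measure Ω}
    [IsProbabilityMeasure P] (hX₁ : X₁ ≤ m) (hX₂ : X₂ ≤ m) (hY₁ : Y₁ ≤ m) (hY₂ : Y₂ ≤ m)
    (hX₁0 : zeroLambda m P ≤ X₁) (hX₂0 : zeroLambda m P ≤ X₂) (hY₂0 : zeroLambda m P ≤ Y₂)
    (hind : Indep (X₁ ⊔ X₂) (Y₁ ⊔ Y₂) P) :
    (X₁ ⊔ Y₁) ⊓ (X₂ ⊔ Y₂) = (X₁ ⊓ X₂) ⊔ (Y₁ ⊓ Y₂) := by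
  have hW₁ : (X₁ ⊓ X₂) ⊔ (Y₁ ⊓ Y₂) ≤ X₁ ⊔ Y₁ := sup_le_sup inf_le_left inf_le_left
  have hW₂ : (X₁ ⊓ X₂) ⊔ (Y₁ ⊓ Y₂) ≤ X₂ ⊔ Y₂ := sup_le_sup inf_le_right inf_le_right
  refine le_antisymm ?_ (le_inf hW₁ hW₂)
  rintro A ⟨hA₁, hA₂⟩
  have hW : (X₁ ⊓ X₂) ⊔ (Y₁ ⊓ Y₂) ≤ m := hW₁.trans (sup_le hX₁ hY₁)
  have hAm : MeasurableSet[m] A := sup_le hX₁ hY₁ _ hA₁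
  set a : Ω → ℝ := A.indicator 1 with ha
  have ha₁ : Measurable[X₁ ⊔ Y₁] a := measurable_indicator_one hA₁
  have ha₂ : Measurable[X₂ ⊔ Y₂] a := measurable_indicator_one hA₂
  have hab : MemLp a ⊤ P := memLp_indicator_const ⊤ hAm 1 (Or.inr (measure_ne_top _ _))
  set a' : Ω → ℝ := P[a | (X₁ ⊓ X₂) ⊔ (Y₁ ⊓ Y₂)] with ha'
  have ham' : Measurable[(X₁ ⊓ X₂) ⊔ (Y₁ ⊓ Y₂)] a' := stronglyMeasurable_condExp.measurable
  have hab' : MemLp a' ⊤ P := hab.condExp le_top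
  have hcentred : P[a - a' | (X₁ ⊓ X₂) ⊔ (Y₁ ⊓ Y₂)] =ᵐ[P] 0 := by
    filter_upwards [condExp_sub (hab.integrable le_top) (hab'.integrable le_top)
      ((X₁ ⊓ X₂) ⊔ (Y₁ ⊓ Y₂))] with x hx
    rw [hx, condExp_of_stronglyMeasurable hW ham'.stronglyMeasurable (hab'.integrable le_top)]
    simp [ha']
  have hzero := ae_eq_zero_of_condExp_inf_sup_inf_eq_zero hX₁ hX₂ hY₁ hY₂ hX₂0 hY₂0 hind
    (ha₁.sub (ham'.mono hW₁ le_rfl)) (ha₂.sub (ham'.mono hW₂ le_rfl)) (hab.sub hab') hcentred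
  have haa' : a =ᵐ[P] a' := by
    filter_upwards [hzero] with x hx
    simpa [sub_eq_zero] using hx
  have ham : Measurable[(X₁ ⊓ X₂) ⊔ (Y₁ ⊓ Y₂)] a :=
    measurable_of_ae_eq_of_zeroLambda_le_s7 hW ((le_inf hX₁0 hX₂0).trans le_sup_left)
      (ha₁.mono (sup_le hX₁ hY₁) le_rfl) ham' haa'
  have hpre : a ⁻¹' {1} = A := by
    ext x
    by_cases h : x ∈ A <;> simp [ha, h]
  rw [← hpre]
  exact ham (measurableSet_singleton 1)

/-- **Distributivity II (ii).** If `X₁ ∨ X₂ ⟂ Y₁ ∨ Y₂` then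
`(X₁ ∨ Y₁) ∧ (X₂ ∨ Y₂) = (X₁ ∧ X₂) ∨ (Y₁ ∧ Y₂)`. In particular, if `X ⊆ A ⟂ Y`
then `(X ∨ Y) ∧ A = X`. -/
theorem stmt7 {Ω : Type*} {m : MeasurableSpace Ω} (P : Measure Ω) [IsProbabilityMeasure P] :
    (∀ X₁ X₂ Y₁ Y₂ : MeasurableSpace Ω,
      X₁ ≤ m → X₂ ≤ m → Y₁ ≤ m → Y₂ ≤ m →
      zeroLambda m P ≤ X₁ → zeroLambda m P ≤ X₂ →
      zeroLambda m P ≤ Y₁ → zeroLambda m P ≤ Y₂ →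
      Indep (X₁ ⊔ X₂) (Y₁ ⊔ Y₂) P →
      (X₁ ⊔ Y₁) ⊓ (X₂ ⊔ Y₂) = (X₁ ⊓ X₂) ⊔ (Y₁ ⊓ Y₂)) ∧
    (∀ X A Y : MeasurableSpace Ω,
      X ≤ m → A ≤ m → Y ≤ m →
      zeroLambda m P ≤ X → zeroLambda m P ≤ A → zeroLambda m P ≤ Y →
      X ≤ A → Indep A Y P →
      (X ⊔ Y) ⊓ A = X) := by
  refine ⟨fun X₁ X₂ Y₁ Y₂ hX₁ hX₂ hY₁ hY₂ hX₁0 hX₂0 _ hY₂0 hind =>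
    sup_inf_sup_eq_of_indep hX₁ hX₂ hY₁ hY₂ hX₁0 hX₂0 hY₂0 hind,
    fun X A Y hX hA hY hX0 hA0 hY0 hXA hind => ?_⟩
  have h := sup_inf_sup_eq_of_indep hX hA hY (hY0.trans hY) hX0 hA0 le_rfl
    (by rwa [sup_eq_right.2 hXA, sup_eq_left.2 hY0])
  rwa [sup_eq_left.2 hA0, inf_eq_left.2 hXA, inf_eq_right.2 hY0, sup_eq_left.2 hX0] at h
end

section
/- Let X, Y, Z be complete sub-σ-fields of a probability space (Ω, M, P). If X ∨ Y is independent of Z, then (X ∨ Z) ∧ (Y ∨ Z) = (X ∧ Y) ∨ Z. -/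
open MeasureTheory ProbabilityTheory

section Auxiliary

variable {Ω : Type*} {m : MeasurableSpace Ω} {P : Measure Ω}

/-- Two integrable functions with equal integrals over all `B ∩ C`, `B ∈ V`, `C ∈ Z`, have equal
integrals over all events of `V ∨ Z`. -/
lemma setIntegral_eq_of_forall_inter {V Z : MeasurableSpace Ω} (hV : V ≤ m) (hZ : Z ≤ m)
    {f g : Ω → ℝ} (hf : Integrable f P) (hg : Integrable g P)
    (h : ∀ B C, MeasurableSet[V] B → MeasurableSet[Z] C →
      ∫ x in B ∩ C, f x ∂P = ∫ x in B ∩ C, g x ∂P)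
    {s : Set Ω} (hs : MeasurableSet[V ⊔ Z] s) :
    ∫ x in s, f x ∂P = ∫ x in s, g x ∂P := by
  have hVZ : V ⊔ Z ≤ m := sup_le hV hZ
  have huniv : ∫ x, f x ∂P = ∫ x, g x ∂P := by
    simpa using h Set.univ Set.univ MeasurableSet.univ MeasurableSet.univ
  have hgen : V ⊔ Z = MeasurableSpace.generateFrom
      {s | ∃ B C, MeasurableSet[V] B ∧ MeasurableSet[Z] C ∧ s = B ∩ C} := by
    refine le_antisymm (sup_le ?_ ?_) (MeasurableSpace.generateFrom_le ?_)
    · intro B hB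
      exact MeasurableSpace.measurableSet_generateFrom
        ⟨B, Set.univ, hB, MeasurableSet.univ, by simp⟩
    · intro C hC
      exact MeasurableSpace.measurableSet_generateFrom
        ⟨Set.univ, C, MeasurableSet.univ, hC, by simp⟩
    · rintro _ ⟨B, C, hB, hC, rfl⟩
      exact MeasurableSet.inter (le_sup_left (a := V) (b := Z) _ hB)
        (le_sup_right (a := V) (b := Z) _ hC)
  induction s, hs using MeasurableSpace.induction_on_inter hgen with
  | h_inter =>
    rintro _ ⟨B, C, hB, hC, rfl⟩ _ ⟨B', C', hB', hC', rfl⟩ _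
    exact ⟨B ∩ B', C ∩ C', hB.inter hB', hC.inter hC', Set.inter_inter_inter_comm _ _ _ _⟩
  | empty => simp
  | basic t ht =>
    obtain ⟨B, C, hB, hC, rfl⟩ := ht
    exact h B C hB hC
  | compl t ht ih =>
    rw [setIntegral_compl (hVZ _ ht) hf, setIntegral_compl (hVZ _ ht) hg, ih, huniv]
  | iUnion t hd ht ih =>
    rw [integral_iUnion (fun i => hVZ _ (ht i)) hd hf.integrableOn,
      integral_iUnion (fun i => hVZ _ (ht i)) hd hg.integrableOn]
    exact tsum_congr ih

/-- A complete sub-σ-field contains every event that is almost surely equal to one of its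
members. -/
lemma measurableSet_of_ae_eq_of_complete {Y : MeasurableSpace Ω} (hY : Y ≤ m)
    (hYc : zeroLambda m P ≤ Y) {s t : Set Ω} (hs : MeasurableSet[m] s)
    (ht : MeasurableSet[Y] t) (hst : s =ᵐ[P] t) : MeasurableSet[Y] s := by
  have hnull : ∀ n, MeasurableSet[m] n → P n = 0 → MeasurableSet[Y] n := fun n hn h0 =>
    hYc _ (MeasurableSpace.measurableSet_generateFrom ⟨hn, Or.inl h0⟩)
  obtain ⟨h1, h2⟩ := ae_eq_set.1 hst
  have : s = (t \ (t \ s)) ∪ (s \ t) := by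
    ext x; simp only [Set.mem_union, Set.mem_sdiff]; tauto
  rw [this]
  exact (ht.diff (hnull _ ((hY _ ht).diff hs) h2)).union (hnull _ (hs.diff (hY _ ht)) h1)

/-- A random variable almost surely equal to one that is measurable for a complete sub-σ-field is
measurable for that sub-σ-field. -/
lemma measurable_of_ae_eq_of_complete {Y : MeasurableSpace Ω} (hY : Y ≤ m)
    (hYc : zeroLambda m P ≤ Y) {f g : Ω → ℝ} (hf : Measurable[m] f) (hg : Measurable[Y] g)
    (hfg : f =ᵐ[P] g) : Measurable[Y] f := fun s hs =>
  measurableSet_of_ae_eq_of_complete hY hYc (hf hs) (hg hs) <| by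
    filter_upwards [hfg] with x hx
    exact congrArg s hx

variable [IsProbabilityMeasure P]

/-- If `U ≤ V` and `V ⟂ Z`, conditioning an event of `V` on `U ∨ Z` is the same as conditioning
it on `U`. -/
lemma condExp_indicator_sup_of_indep {U V Z : MeasurableSpace Ω} (hUV : U ≤ V) (hV : V ≤ m)
    (hZ : Z ≤ m) (hInd : Indep V Z P) {B : Set Ω} (hB : MeasurableSet[V] B) :
    P[B.indicator (fun _ => (1 : ℝ)) | U] =ᵐ[P] P[B.indicator (fun _ => (1 : ℝ)) | U ⊔ Z] := by
  have hU : U ≤ m := hUV.trans hV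
  have hUZ : U ⊔ Z ≤ m := sup_le hU hZ
  have hint : Integrable (B.indicator (fun _ => (1 : ℝ))) P :=
    (integrable_const 1).indicator (hV _ hB)
  refine ae_eq_condExp_of_forall_setIntegral_eq hUZ hint
    (fun _ _ _ => integrable_condExp.integrableOn) ?_
    (stronglyMeasurable_condExp.mono le_sup_left).aestronglyMeasurable
  have key : ∀ (g : Ω → ℝ), Integrable g P → StronglyMeasurable[V] g → ∀ C, MeasurableSet[Z] C →
      ∫ x in C, g x ∂P = P.real C * ∫ x, g x ∂P := by
    intro g hg hgV C hC
    have h := setIntegral_condExp hZ hg hC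
    rw [setIntegral_congr_ae (hZ _ hC)
      ((condExp_indep_eq hV hZ hgV hInd).mono fun x hx _ => hx)] at h
    rw [← h]
    simp
  intro s hs _
  refine setIntegral_eq_of_forall_inter hU hZ integrable_condExp hint ?_ hs
  intro D C hD hC
  have hDm := hU _ hD
  rw [Set.inter_comm, ← setIntegral_indicator hDm, ← setIntegral_indicator hDm,
    key _ (integrable_condExp.indicator hDm)
      ((stronglyMeasurable_condExp.mono hUV).indicator (hUV _ hD)) C hC,
    key _ (hint.indicator hDm)
      ((stronglyMeasurable_const.indicator hB).indicator (hUV _ hD)) C hC,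
    integral_indicator hDm, integral_indicator hDm, setIntegral_condExp hU hint hD]

/-- If `U ≤ V` and `V ⟂ Z`, conditioning a `U ∨ Z`-measurable variable on `V` is the same as
conditioning it on `U`. -/
lemma condExp_eq_of_indep_of_stronglyMeasurable_sup {U V Z : MeasurableSpace Ω} (hUV : U ≤ V)
    (hV : V ≤ m) (hZ : Z ≤ m) (hInd : Indep V Z P) {g : Ω → ℝ} (hg : Integrable g P)
    (hgm : StronglyMeasurable[U ⊔ Z] g) : P[g | U] =ᵐ[P] P[g | V] := by
  have hU : U ≤ m := hUV.trans hV
  have hUZ : U ⊔ Z ≤ m := sup_le hU hZ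
  refine ae_eq_condExp_of_forall_setIntegral_eq hV hg
    (fun _ _ _ => integrable_condExp.integrableOn) ?_
    (stronglyMeasurable_condExp.mono hUV).aestronglyMeasurable
  intro B hB _
  have hBm := hV _ hB
  set b : Ω → ℝ := B.indicator (fun _ => (1 : ℝ)) with hb
  have hbint : Integrable b P := (integrable_const 1).indicator hBm
  have hmul : ∀ f : Ω → ℝ, f * b = B.indicator f := by
    intro f
    ext x
    by_cases hx : x ∈ B <;> simp [hb, hx]
  have hbdd : ∀ᵐ x ∂P, ‖(P[b | U]) x‖ ≤ 1 := by
    have := ae_bdd_abs_condExp_of_ae_bdd_abs (m := U) (R := (1 : ℝ)) (μ := P) (f := b)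
      (ae_of_all _ fun x => by by_cases hx : x ∈ B <;> simp [hb, hx])
    simpa using this
  have hgb : Integrable (g * P[b | U]) P :=
    hg.mul_bdd (c := 1) (stronglyMeasurable_condExp.mono hU).aestronglyMeasurable hbdd
  have hfb : ∀ f : Ω → ℝ, Integrable f P → Integrable (f * b) P := fun f hf => by
    rw [hmul]; exact hf.indicator hBm
  have hset : ∀ f : Ω → ℝ, ∫ x in B, f x ∂P = ∫ x, (f * b) x ∂P := fun f => by
    rw [hmul, integral_indicator hBm]
  rw [hset, hset]
  calc ∫ x, (P[g | U] * b) x ∂P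
      = ∫ x, (P[P[g | U] * b | U]) x ∂P := (integral_condExp hU).symm
    _ = ∫ x, (P[g | U] * P[b | U]) x ∂P := integral_congr_ae
        (condExp_mul_of_stronglyMeasurable_left stronglyMeasurable_condExp
          (hfb _ integrable_condExp) hbint)
    _ = ∫ x, (P[g * P[b | U] | U]) x ∂P := integral_congr_ae
        (condExp_mul_of_stronglyMeasurable_right stronglyMeasurable_condExp hgb hg).symm
    _ = ∫ x, (g * P[b | U]) x ∂P := integral_condExp hU
    _ = ∫ x, (g * P[b | U ⊔ Z]) x ∂P := integral_congr_ae <| by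
        filter_upwards [condExp_indicator_sup_of_indep hUV hV hZ hInd hB] with x hx
        simp only [Pi.mul_apply, hb, hx]
    _ = ∫ x, (P[g * b | U ⊔ Z]) x ∂P := integral_congr_ae
        (condExp_mul_of_stronglyMeasurable_left hgm (hfb _ hg) hbint).symm
    _ = ∫ x, (g * b) x ∂P := integral_condExp hUZ

/-- If the conditional expectations on two sub-σ-fields, the second one complete, agree, then they
agree with the one on the intersection. -/
lemma condExp_inf_eq_of_complete {X Y : MeasurableSpace Ω} (hX : X ≤ m) (hY : Y ≤ m)
    (hYc : zeroLambda m P ≤ Y) {f : Ω → ℝ} (h : P[f | X] =ᵐ[P] P[f | Y]) :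
    P[f | X ⊓ Y] =ᵐ[P] P[f | X] := by
  have hXY : X ⊓ Y ≤ m := inf_le_left.trans hX
  have hmX : Measurable[X] (P[f | X]) := stronglyMeasurable_condExp.measurable
  have hmY : Measurable[Y] (P[f | X]) := measurable_of_ae_eq_of_complete hY hYc
    (hmX.mono hX le_rfl) stronglyMeasurable_condExp.measurable h
  have hm : Measurable[X ⊓ Y] (P[f | X]) := fun s hs => ⟨hmX hs, hmY hs⟩
  have := condExp_condExp_of_le (μ := P) (f := f) (inf_le_left : X ⊓ Y ≤ X) hX
  rw [condExp_of_stronglyMeasurable hXY hm.stronglyMeasurable integrable_condExp] at this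
  exact this.symm

end Auxiliary

/-- **Distributivity II (iii).** If `X ∨ Y ⟂ Z` then
`(X ∨ Z) ∧ (Y ∨ Z) = (X ∧ Y) ∨ Z`. -/
theorem stmt8 {Ω : Type*} {m : MeasurableSpace Ω} (P : Measure Ω) [IsProbabilityMeasure P]
    (X Y Z : MeasurableSpace Ω) (hXm : X ≤ m) (hYm : Y ≤ m) (hZm : Z ≤ m)
    (hXc : zeroLambda m P ≤ X) (hYc : zeroLambda m P ≤ Y) (hZc : zeroLambda m P ≤ Z)
    (hInd : Indep (X ⊔ Y) Z P) :
    (X ⊔ Z) ⊓ (Y ⊔ Z) = (X ⊓ Y) ⊔ Z := by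
  refine le_antisymm ?_ (le_inf (sup_le_sup_right inf_le_left Z) (sup_le_sup_right inf_le_right Z))
  rintro A ⟨hAX, hAY⟩
  have hV : X ⊔ Y ≤ m := sup_le hXm hYm
  have hW : (X ⊓ Y) ⊔ Z ≤ m := sup_le (inf_le_left.trans hXm) hZm
  have hT : (X ⊔ Y) ⊔ Z ≤ m := sup_le hV hZm
  have hWT : (X ⊓ Y) ⊔ Z ≤ (X ⊔ Y) ⊔ Z := sup_le_sup_right (inf_le_left.trans le_sup_left) Z
  have hAT : MeasurableSet[(X ⊔ Y) ⊔ Z] A := sup_le_sup_right le_sup_left Z _ hAX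
  have hAm : MeasurableSet[m] A := hT _ hAT
  set f : Ω → ℝ := A.indicator (fun _ => (1 : ℝ)) with hfdef
  have hf : Integrable f P := (integrable_const 1).indicator hAm
  have hfX : StronglyMeasurable[X ⊔ Z] f := stronglyMeasurable_const.indicator hAX
  have hfY : StronglyMeasurable[Y ⊔ Z] f := stronglyMeasurable_const.indicator hAY
  have hset : ∀ s, MeasurableSet[(X ⊔ Y) ⊔ Z] s →
      ∫ x in s, (P[f | (X ⊓ Y) ⊔ Z]) x ∂P = ∫ x in s, f x ∂P := by
    intro s hs
    refine setIntegral_eq_of_forall_inter hV hZm integrable_condExp hf ?_ hs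
    intro B C hB hC
    have hCm := hZm _ hC
    have hF : Integrable (C.indicator f) P := hf.indicator hCm
    have hFX := condExp_eq_of_indep_of_stronglyMeasurable_sup le_sup_left hV hZm hInd hF
      (hfX.indicator (le_sup_right (a := X) (b := Z) _ hC))
    have hFY := condExp_eq_of_indep_of_stronglyMeasurable_sup le_sup_right hV hZm hInd hF
      (hfY.indicator (le_sup_right (a := Y) (b := Z) _ hC))
    have hFinf := (condExp_inf_eq_of_complete hXm hYm hYc (hFX.trans hFY.symm)).trans hFX
    have hG := condExp_eq_of_indep_of_stronglyMeasurable_sup (U := X ⊓ Y) (V := X ⊔ Y)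
      (g := P[C.indicator f | (X ⊓ Y) ⊔ Z])
      (inf_le_left.trans le_sup_left) hV hZm hInd integrable_condExp stronglyMeasurable_condExp
    have htower := condExp_condExp_of_le (μ := P) (f := C.indicator f)
      (le_sup_left : X ⊓ Y ≤ (X ⊓ Y) ⊔ Z) hW
    have hVeq : P[P[C.indicator f | (X ⊓ Y) ⊔ Z] | X ⊔ Y] =ᵐ[P] P[C.indicator f | X ⊔ Y] :=
      hG.symm.trans (htower.trans hFinf)
    have hind : P[C.indicator f | (X ⊓ Y) ⊔ Z] =ᵐ[P] C.indicator (P[f | (X ⊓ Y) ⊔ Z]) :=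
      condExp_indicator hf (le_sup_right (a := X ⊓ Y) (b := Z) _ hC)
    calc ∫ x in B ∩ C, (P[f | (X ⊓ Y) ⊔ Z]) x ∂P
        = ∫ x in B, C.indicator (P[f | (X ⊓ Y) ⊔ Z]) x ∂P := (setIntegral_indicator hCm).symm
      _ = ∫ x in B, (P[C.indicator f | (X ⊓ Y) ⊔ Z]) x ∂P :=
          (integral_congr_ae (ae_restrict_of_ae hind)).symm
      _ = ∫ x in B, (P[P[C.indicator f | (X ⊓ Y) ⊔ Z] | X ⊔ Y]) x ∂P :=
          (setIntegral_condExp hV integrable_condExp hB).symm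
      _ = ∫ x in B, (P[C.indicator f | X ⊔ Y]) x ∂P :=
          integral_congr_ae (ae_restrict_of_ae hVeq)
      _ = ∫ x in B, C.indicator f x ∂P := setIntegral_condExp hV hF hB
      _ = ∫ x in B ∩ C, f x ∂P := setIntegral_indicator hCm
  have hae : P[f | (X ⊓ Y) ⊔ Z] =ᵐ[P] f := by
    have := ae_eq_condExp_of_forall_setIntegral_eq hT hf
      (g := P[f | (X ⊓ Y) ⊔ Z]) (fun _ _ _ => integrable_condExp.integrableOn)
      (fun s hs _ => hset s hs) (stronglyMeasurable_condExp.mono hWT).aestronglyMeasurable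
    rwa [condExp_of_stronglyMeasurable hT (stronglyMeasurable_const.indicator hAT) hf] at this
  have hfW : Measurable[(X ⊓ Y) ⊔ Z] f := measurable_of_ae_eq_of_complete hW
    (hZc.trans le_sup_right) (measurable_const.indicator hAm)
    stronglyMeasurable_condExp.measurable hae.symm
  have hpre : A = f ⁻¹' {1} := by
    ext x
    by_cases hx : x ∈ A <;> simp [hfdef, hx]
  rw [hpre]
  exact hfW (measurableSet_singleton 1)
end

section
/- Let A, B, C be complete sub-σ-fields of a probability space (Ω, M, P). (I) If A ⊆ B ∨ C and A ∨ B is independent of C, then A ⊆ B. (II) If A ⊆ B ∨ C, A is independent of C, and B ⊆ A, then A = B. -/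
open MeasureTheory ProbabilityTheory

/-- The intersections `b ∩ c` with `b ∈ B` and `c ∈ C` generate `B ⊔ C`. -/
theorem MeasurableSpace.sup_eq_generateFrom_image2_inter {Ω : Type*} (B C : MeasurableSpace Ω) :
    B ⊔ C = MeasurableSpace.generateFrom
      (Set.image2 (· ∩ ·) {b | MeasurableSet[B] b} {c | MeasurableSet[C] c}) := by
  apply le_antisymm
  · refine sup_le (fun b hb => ?_) (fun c hc => ?_)
    · exact MeasurableSpace.measurableSet_generateFrom
        ⟨b, hb, Set.univ, @MeasurableSet.univ _ C, Set.inter_univ b⟩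
    · exact MeasurableSpace.measurableSet_generateFrom
        ⟨Set.univ, @MeasurableSet.univ _ B, c, hc, Set.univ_inter c⟩
  · refine MeasurableSpace.generateFrom_le ?_
    rintro _ ⟨b, hb, c, hc, rfl⟩
    exact @MeasurableSet.inter _ (B ⊔ C) _ _ ((le_sup_left : B ≤ B ⊔ C) _ hb)
      ((le_sup_right : C ≤ B ⊔ C) _ hc)

theorem MeasurableSpace.isPiSystem_image2_inter {Ω : Type*} (B C : MeasurableSpace Ω) :
    IsPiSystem (Set.image2 (· ∩ ·) {b | MeasurableSet[B] b} {c | MeasurableSet[C] c}) := by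
  rintro _ ⟨b, hb, c, hc, rfl⟩ _ ⟨b', hb', c', hc', rfl⟩ -
  exact ⟨b ∩ b', @MeasurableSet.inter _ B _ _ hb hb', c ∩ c', @MeasurableSet.inter _ C _ _ hc hc',
    Set.inter_inter_inter_comm b b' c c'⟩

/-- An integrable function whose integral vanishes on all sets `b ∩ c` with `b ∈ B` and `c ∈ C`
has vanishing integral on every set of `B ⊔ C`. -/
theorem setIntegral_eq_zero_of_forall_inter {Ω : Type*} {m : MeasurableSpace Ω} {P : Measure Ω}
    {B C : MeasurableSpace Ω} (hB : B ≤ m) (hC : C ≤ m) {h : Ω → ℝ} (hint : Integrable h P)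
    (hzero : ∀ b c, MeasurableSet[B] b → MeasurableSet[C] c → ∫ x in b ∩ c, h x ∂P = 0)
    {t : Set Ω} (ht : MeasurableSet[B ⊔ C] t) : ∫ x in t, h x ∂P = 0 := by
  have hBC : B ⊔ C ≤ m := sup_le hB hC
  have huniv : ∫ x, h x ∂P = 0 := by
    simpa using hzero Set.univ Set.univ (@MeasurableSet.univ _ B) (@MeasurableSet.univ _ C)
  refine MeasurableSpace.induction_on_inter (C := fun t _ => ∫ x in t, h x ∂P = 0)
    (MeasurableSpace.sup_eq_generateFrom_image2_inter B C)
    (MeasurableSpace.isPiSystem_image2_inter B C) (by simp) ?_ ?_ ?_ t ht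
  · rintro _ ⟨b, hb, c, hc, rfl⟩
    exact hzero b c hb hc
  · intro s hs hs0
    have := integral_add_compl (hBC s hs) hint
    rwa [hs0, zero_add, huniv] at this
  · intro f hf hfm hf0
    rw [integral_iUnion (fun i => hBC _ (hfm i)) hf hint.integrableOn]
    simp [hf0]

/-- If `E ∈ A` and `A ⊔ B` is independent of `C`, then conditioning the indicator of `E` on `B ⊔ C`
is the same as conditioning it on `B`. -/
theorem condExp_indicator_sup_ae_eq_of_indep {Ω : Type*} {m : MeasurableSpace Ω} {P : Measure Ω}
    [IsProbabilityMeasure P] {A B C : MeasurableSpace Ω} (hA : A ≤ m) (hB : B ≤ m) (hC : C ≤ m)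
    (hind : Indep (A ⊔ B) C P) {E : Set Ω} (hE : MeasurableSet[A] E) :
    P[E.indicator (fun _ => (1 : ℝ)) | B] =ᵐ[P]
      P[E.indicator (fun _ => (1 : ℝ)) | B ⊔ C] := by
  set f : Ω → ℝ := E.indicator (fun _ => (1 : ℝ)) with hf
  have hfint : Integrable f P := (integrable_const (1 : ℝ)).indicator (hA E hE)
  have hfm : StronglyMeasurable[A ⊔ B] f :=
    (@stronglyMeasurable_const _ _ (A ⊔ B) _ (1 : ℝ)).indicator ((le_sup_left : A ≤ A ⊔ B) E hE)
  have hgm : StronglyMeasurable[B] (P[f | B]) := stronglyMeasurable_condExp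
  refine ae_eq_condExp_of_forall_setIntegral_eq (sup_le hB hC) hfint
    (fun _ _ _ => integrable_condExp.integrableOn) (fun s hs _ => ?_)
    (hgm.mono (le_sup_left : B ≤ B ⊔ C)).aestronglyMeasurable
  have hdiff : Integrable (fun x => (P[f | B]) x - f x) P := integrable_condExp.sub hfint
  rw [← sub_eq_zero, ← integral_sub integrable_condExp.integrableOn hfint.integrableOn]
  refine setIntegral_eq_zero_of_forall_inter hB hC hdiff (fun b c hb hc => ?_) hs
  set k : Ω → ℝ := b.indicator fun x => (P[f | B]) x - f x with hk
  have hkm : StronglyMeasurable[A ⊔ B] k :=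
    ((hgm.mono le_sup_right).sub hfm).indicator ((le_sup_right : B ≤ A ⊔ B) b hb)
  have hkint : Integrable k P := hdiff.indicator (hB b hb)
  have hk0 : ∫ x, k x ∂P = 0 := by
    rw [hk, integral_indicator (hB b hb),
      integral_sub integrable_condExp.integrableOn hfint.integrableOn,
      setIntegral_condExp hB hfint hb, sub_self]
  have hcond : P[k | C] =ᵐ[P] fun _ => (0 : ℝ) := by
    simpa [hk0] using condExp_indep_eq (sup_le hA hB) hC hkm hind
  rw [Set.inter_comm, ← setIntegral_indicator (hB b hb), ← hk, ← setIntegral_condExp hC hkint hc,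
    setIntegral_congr_ae (hC c hc) (hcond.mono fun x hx _ => hx)]
  simp

/-- A complete sub-σ-field contains every event that is almost everywhere equal to one of its
members. -/
theorem measurableSet_of_ae_eq_of_zeroLambda_le_s9 {Ω : Type*} {m : MeasurableSpace Ω}
    {P : Measure Ω} {B : MeasurableSpace Ω} (hB : B ≤ m) (h0 : zeroLambda m P ≤ B)
    {E S : Set Ω} (hE : MeasurableSet[m] E) (hS : MeasurableSet[B] S) (hES : E =ᵐ[P] S) :
    MeasurableSet[B] E := by
  have hnull : ∀ N, MeasurableSet[m] N → P N = 0 → MeasurableSet[B] N := fun N hN hN0 =>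
    h0 N (MeasurableSpace.measurableSet_generateFrom ⟨hN, Or.inl hN0⟩)
  obtain ⟨h₁, h₂⟩ := ae_eq_set.1 hES
  have hES' : E = (S \ (S \ E)) ∪ (E \ S) := by
    ext x; by_cases x ∈ E <;> by_cases x ∈ S <;> simp_all
  rw [hES']
  exact @MeasurableSet.union _ B _ _
    (@MeasurableSet.diff _ B _ _ hS (hnull _ ((hB S hS).diff hE) h₂))
    (hnull _ (hE.diff (hB S hS)) h₁)

theorem le_of_le_sup_of_indep {Ω : Type*} {m : MeasurableSpace Ω} {P : Measure Ω}
    [IsProbabilityMeasure P] {A B C : MeasurableSpace Ω} (hA : A ≤ m) (hB : B ≤ m) (hC : C ≤ m)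
    (h0 : zeroLambda m P ≤ B) (hle : A ≤ B ⊔ C) (hind : Indep (A ⊔ B) C P) : A ≤ B := by
  intro E hE
  have hfint : Integrable (E.indicator fun _ => (1 : ℝ)) P :=
    (integrable_const (1 : ℝ)).indicator (hA E hE)
  have hgm : StronglyMeasurable[B] (P[E.indicator (fun _ => (1 : ℝ)) | B]) :=
    stronglyMeasurable_condExp
  have hg := condExp_indicator_sup_ae_eq_of_indep hA hB hC hind hE
  rw [condExp_of_stronglyMeasurable (sup_le hB hC)
    ((@stronglyMeasurable_const _ _ (B ⊔ C) _ (1 : ℝ)).indicator (hle E hE)) hfint] at hg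
  refine measurableSet_of_ae_eq_of_zeroLambda_le_s9 hB h0 (hA E hE)
    (hgm.measurable (measurableSet_singleton (1 : ℝ))) ?_
  filter_upwards [hg] with x hx
  apply propext
  change x ∈ E ↔ (P[E.indicator (fun _ => (1 : ℝ)) | B]) x = 1
  rw [hx]
  by_cases hxE : x ∈ E <;> simp [hxE]

/-- (I) If `A ⊆ B ∨ C` and `A ∨ B ⟂ C`, then `A ⊆ B`.
(II) If `A ⊆ B ∨ C`, `A ⟂ C` and `B ⊆ A`, then `A = B`. -/
theorem stmt9 {Ω : Type*} {m : MeasurableSpace Ω} (P : Measure Ω) [IsProbabilityMeasure P] :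
    (∀ A B C : MeasurableSpace Ω,
      A ≤ m → B ≤ m → C ≤ m →
      zeroLambda m P ≤ A → zeroLambda m P ≤ B → zeroLambda m P ≤ C →
      A ≤ B ⊔ C → Indep (A ⊔ B) C P → A ≤ B) ∧
    (∀ A B C : MeasurableSpace Ω,
      A ≤ m → B ≤ m → C ≤ m →
      zeroLambda m P ≤ A → zeroLambda m P ≤ B → zeroLambda m P ≤ C →
      A ≤ B ⊔ C → Indep A C P → B ≤ A → A = B) := by
  refine ⟨fun A B C hA hB hC _ h0 _ hle hind => le_of_le_sup_of_indep hA hB hC h0 hle hind,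
    fun A B C hA hB hC _ h0 _ hle hind hBA => le_antisymm ?_ hBA⟩
  exact le_of_le_sup_of_indep hA hB hC h0 hle (by rwa [sup_eq_left.2 hBA])
end

section
/- Let X, Y, Z be complete sub-σ-fields of a probability space (Ω, M, P) with Y ⊆ X, X ∨ Z countably generated up to negligible sets, and X conditionally non-atomic given Y. If X and Z are independent, then X ∨ Z is conditionally non-atomic given Y ∨ Z. -/
open MeasureTheory ProbabilityTheory

/-- `σ̄(ξ)`: the smallest complete sub-σ-field making `ξ` measurable, i.e.
`σ(ξ) ∨ 0_Λ`. -/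
def sigmaBar {Ω : Type*} {E : Type*} [MeasurableSpace E] (m : MeasurableSpace Ω)
    (P : @MeasureTheory.Measure Ω m) (ξ : Ω → E) : MeasurableSpace Ω :=
  MeasurableSpace.comap ξ inferInstance ⊔ zeroLambda m P

/-- `X` is conditionally non-atomic given `Y` (for `Y ⊆ X`, `X` essentially separable):
there is an `X`-measurable random variable `Z` with values in `[0,1]`, uniform law,
independent of `Y`, such that `Y ∨ σ̄(Z) = X`. -/
def CondNonAtomic {Ω : Type*} (m : MeasurableSpace Ω) (P : @MeasureTheory.Measure Ω m)
    (X Y : MeasurableSpace Ω) : Prop :=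
  ∃ Z : Ω → ℝ, Measurable[X] Z ∧ (∀ ω, Z ω ∈ Set.Icc (0 : ℝ) 1) ∧
    @MeasureTheory.Measure.map Ω ℝ m _ Z P = volume.restrict (Set.Icc (0 : ℝ) 1) ∧
    Indep (MeasurableSpace.comap Z inferInstance) Y P ∧
    Y ⊔ sigmaBar m P Z = X

/-- If `U, Y ⊆ X` are independent and `X` is independent of `Z`, then `U` is independent
of `Y ⊔ Z`. -/
theorem indep_sup_right_of_le_of_indep {Ω : Type*} {m : MeasurableSpace Ω}
    (P : Measure Ω) [IsProbabilityMeasure P] {U X Y Z : MeasurableSpace Ω}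
    (hUm : U ≤ m) (hYm : Y ≤ m) (hZm : Z ≤ m) (hUX : U ≤ X) (hYX : Y ≤ X)
    (hUY : Indep U Y P) (hXZ : Indep X Z P) : Indep U (Y ⊔ Z) P := by
  set R : Set (Set Ω) := {C | ∃ A B, MeasurableSet[Y] A ∧ MeasurableSet[Z] B ∧ A ∩ B = C}
  have hgen : Y ⊔ Z = MeasurableSpace.generateFrom R := by
    apply le_antisymm
    · refine sup_le (fun A hA => ?_) (fun B hB => ?_)
      · exact MeasurableSpace.measurableSet_generateFrom
          ⟨A, Set.univ, hA, MeasurableSet.univ, Set.inter_univ A⟩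
      · exact MeasurableSpace.measurableSet_generateFrom
          ⟨Set.univ, B, MeasurableSet.univ, hB, Set.univ_inter B⟩
    · refine MeasurableSpace.generateFrom_le ?_
      rintro _ ⟨A, B, hA, hB, rfl⟩
      exact MeasurableSet.inter (le_sup_left (a := Y) (b := Z) A hA)
        (le_sup_right (a := Y) (b := Z) B hB)
  have hpi : IsPiSystem R := by
    rintro _ ⟨A, B, hA, hB, rfl⟩ _ ⟨A', B', hA', hB', rfl⟩ -
    exact ⟨A ∩ A', B ∩ B', hA.inter hA', hB.inter hB', Set.inter_inter_inter_comm A A' B B'⟩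
  refine IndepSets.indep hUm (sup_le hYm hZm) (@MeasurableSpace.isPiSystem_measurableSet Ω U) hpi
    (@MeasurableSpace.generateFrom_measurableSet Ω U).symm hgen ?_
  rw [IndepSets_iff]
  rintro S _ hS ⟨A, B, hA, hB, rfl⟩
  rw [Indep_iff] at hUY hXZ
  rw [← Set.inter_assoc, hXZ (S ∩ A) B (MeasurableSet.inter (hUX S hS) (hYX A hA)) hB,
    hUY S A hS hA, hXZ A B (hYX A hA) hB, mul_assoc]

/-- If `X` is conditionally non-atomic given `Y` and `X ⟂ Z`, then `X ∨ Z` is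
conditionally non-atomic given `Y ∨ Z`. -/
theorem stmt12 {Ω : Type*} {m : MeasurableSpace Ω} (P : Measure Ω) [IsProbabilityMeasure P]
    (X Y Z : MeasurableSpace Ω) (hXm : X ≤ m) (hYm : Y ≤ m) (hZm : Z ≤ m)
    (hXc : zeroLambda m P ≤ X) (hYc : zeroLambda m P ≤ Y) (hZc : zeroLambda m P ≤ Z)
    (hYX : Y ≤ X)
    (hsep : ∃ ξ : Ω → ℝ, Measurable[m] ξ ∧ X ⊔ Z = sigmaBar m P ξ)
    (hCNA : CondNonAtomic m P X Y)
    (hInd : Indep X Z P) :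
    CondNonAtomic m P (X ⊔ Z) (Y ⊔ Z) := by
  obtain ⟨U, hUX, hU01, hUlaw, hUY, hgen⟩ := hCNA
  refine ⟨U, hUX.mono le_sup_left le_rfl, hU01, hUlaw, ?_, ?_⟩
  · exact indep_sup_right_of_le_of_indep P (hUX.comap_le.trans hXm) hYm hZm
      hUX.comap_le hYX hUY hInd
  · rw [sup_right_comm, hgen]
end

section
/- Let X, Y be complete sub-σ-fields of a probability space (Ω, M, P) with Y ⊆ X, X countably generated up to negligible sets, and X conditionally non-atomic given Y. Let 𝒫 ⊆ X be a countable partition of Ω into X-measurable sets. Then X is conditionally non-atomic given Y ∨ σ̄(𝒫). If moreover σ̄(𝒫) is independent of Y, then there exists an X-measurable random variable Z with values in [0,1] and uniform law such that Z is independent of Y, Y ∨ σ̄(Z) = X, and σ̄(𝒫) ⊆ σ̄(Z). -/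
open MeasureTheory ProbabilityTheory

/-- `σ̄(Ps)` for a collection `Ps` of sets: `σ(Ps) ∨ 0_Λ`. -/
def sigmaBarSet {Ω : Type*} (m : MeasurableSpace Ω) (P : @MeasureTheory.Measure Ω m)
    (Ps : Set (Set Ω)) : MeasurableSpace Ω :=
  MeasurableSpace.generateFrom Ps ⊔ zeroLambda m P

/-- The uniform law on `[0,1]`, as a measure on `ℝ`. -/
noncomputable def unifLaw : Measure ℝ := volume.restrict (Set.Icc (0 : ℝ) 1)

instance : IsProbabilityMeasure unifLaw := ⟨by simp [unifLaw]⟩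

instance : NullSingletonClass unifLaw := by unfold unifLaw; infer_instance

theorem continuous_cdf (μ : Measure ℝ) [IsProbabilityMeasure μ] [NullSingletonClass μ] :
    Continuous (cdf μ) := by
  refine continuous_iff_continuousAt.2 fun a => ?_
  rw [(monotone_cdf μ).continuousAt_iff_leftLim_eq_rightLim, StieltjesFunction.rightLim_eq]
  refine le_antisymm ((monotone_cdf μ).leftLim_le le_rfl) ?_
  have h := (cdf μ).measure_singleton a
  rw [measure_cdf, measure_singleton, eq_comm, ENNReal.ofReal_eq_zero] at h
  linarith

theorem measure_gt_cdf_le_cdf (μ : Measure ℝ) [IsProbabilityMeasure μ] [NullSingletonClass μ]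
    (q : ℝ) :
    μ {t | q < t ∧ cdf μ t ≤ cdf μ q} = 0 := by
  set S := {t | q < t ∧ cdf μ t ≤ cdf μ q}
  have hIoc (s : ℝ) (hs : cdf μ s ≤ cdf μ q) : μ (Set.Ioc q s) = 0 := by
    conv_lhs => rw [← measure_cdf μ]
    rw [StieltjesFunction.measure_Ioc]
    exact ENNReal.ofReal_eq_zero.2 (by linarith)
  rcases S.eq_empty_or_nonempty with h0 | hne
  · simp [h0]
  by_cases hb : BddAbove S
  · refine measure_mono_null (t := Set.Ioc q (sSup S)) (fun t ht => ⟨ht.1, le_csSup hb ht⟩)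
      (hIoc _ ?_)
    have hcl : IsClosed {t | cdf μ t ≤ cdf μ q} :=
      isClosed_le (continuous_cdf μ) continuous_const
    exact hcl.closure_subset_iff.2 (fun t ht => ht.2) (csSup_mem_closure hne hb)
  · have hall (s : ℝ) : cdf μ s ≤ cdf μ q := by
      obtain ⟨t, ht, hst⟩ := not_bddAbove_iff.1 hb s
      exact (monotone_cdf μ hst.le).trans ht.2
    refine measure_mono_null (t := ⋃ n : ℕ, Set.Ioc q n) (fun t ht => ?_)
      (measure_iUnion_null fun n => hIoc n (hall n))
    obtain ⟨n, hn⟩ := exists_nat_ge t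
    exact Set.mem_iUnion.2 ⟨n, ht.1, hn⟩

theorem measure_cdf_le_cdf (μ : Measure ℝ) [IsProbabilityMeasure μ] [NullSingletonClass μ]
    (q : ℝ) :
    μ {t | cdf μ t ≤ cdf μ q} = ENNReal.ofReal (cdf μ q) := by
  rw [ofReal_cdf]
  refine le_antisymm ?_ (measure_mono fun t ht => monotone_cdf μ ht)
  calc μ {t | cdf μ t ≤ cdf μ q}
      ≤ μ (Set.Iic q ∪ {t | q < t ∧ cdf μ t ≤ cdf μ q}) :=
        measure_mono fun t ht => (le_or_gt t q).imp id fun h => ⟨h, ht⟩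
    _ ≤ _ := (measure_union_le _ _).trans (by rw [measure_gt_cdf_le_cdf, add_zero])

theorem unifLaw_Iic {x : ℝ} (h1 : x ≤ 1) :
    unifLaw (Set.Iic x) = ENNReal.ofReal x := by
  rw [unifLaw, Measure.restrict_apply measurableSet_Iic]
  have : Set.Iic x ∩ Set.Icc 0 1 = Set.Icc 0 x := by
    ext t
    simp only [Set.mem_inter_iff, Set.mem_Iic, Set.mem_Icc]
    grind
  rw [this, Real.volume_Icc, sub_zero]

theorem map_cdf_eq_unifLaw (μ : Measure ℝ) [IsProbabilityMeasure μ] [NullSingletonClass μ] :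
    μ.map (cdf μ) = unifLaw := by
  have hm : Measurable (cdf μ) := (continuous_cdf μ).measurable
  have : IsProbabilityMeasure (μ.map (cdf μ)) := Measure.isProbabilityMeasure_map hm.aemeasurable
  refine Measure.ext_of_Iic _ _ fun x => ?_
  rw [Measure.map_apply hm measurableSet_Iic]
  change μ {t | cdf μ t ≤ x} = _
  rcases lt_or_ge x 0 with hx0 | hx0
  · have h1 : {t | cdf μ t ≤ x} = ∅ :=
      Set.eq_empty_of_forall_notMem fun t ht => (hx0.trans_le (cdf_nonneg μ t)).not_ge ht
    have h2 : unifLaw (Set.Iic x) ≤ unifLaw (Set.Iic 0 \ {0}) :=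
      measure_mono fun t ht => ⟨ht.trans hx0.le, (lt_of_le_of_lt ht hx0).ne⟩
    rw [measure_sdiff_null (measure_singleton 0), unifLaw_Iic zero_le_one] at h2
    simpa [h1, eq_comm] using h2
  rcases le_or_gt 1 x with hx1 | hx1
  · have h1 : {t | cdf μ t ≤ x} = Set.univ :=
      Set.eq_univ_of_forall fun t => (cdf_le_one μ t).trans hx1
    have h2 : unifLaw (Set.Iic 1) ≤ unifLaw (Set.Iic x) := measure_mono (Set.Iic_subset_Iic.2 hx1)
    rw [unifLaw_Iic le_rfl, ENNReal.ofReal_one] at h2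
    rw [h1, measure_univ, le_antisymm prob_le_one h2]
  rw [unifLaw_Iic hx1.le]
  by_cases hq : ∃ q, cdf μ q = x
  · obtain ⟨q, rfl⟩ := hq
    exact measure_cdf_le_cdf μ q
  · have hx : x ≤ 0 := by
      by_contra! hx
      obtain ⟨a, ha⟩ := ((tendsto_cdf_atBot μ).eventually_lt_const hx).exists
      obtain ⟨b, hb⟩ := ((tendsto_cdf_atTop μ).eventually_const_lt hx1).exists
      exact hq (mem_range_of_exists_le_of_exists_ge (continuous_cdf μ) ⟨a, ha.le⟩ ⟨b, hb.le⟩)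
    have h1 : {t | cdf μ t ≤ x} = ∅ := Set.eq_empty_of_forall_notMem fun t ht =>
      hq ⟨t, le_antisymm ht (hx.trans (cdf_nonneg μ t))⟩
    rw [h1, measure_empty, ENNReal.ofReal_of_nonpos hx]

/-- The distribution function at `t` of `μ` conditioned on `S` (zero if `S` is `μ`-null). -/
noncomputable def condCdf (μ : Measure ℝ) (S : Set ℝ) (t : ℝ) : ℝ :=
  μ.real {s | s ≤ t ∧ s ∈ S} / μ.real S

theorem condCdf_mem_Icc (μ : Measure ℝ) [IsFiniteMeasure μ] (S : Set ℝ) (t : ℝ) :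
    condCdf μ S t ∈ Set.Icc (0 : ℝ) 1 :=
  ⟨by unfold condCdf; positivity,
    div_le_one_of_le₀ (measureReal_mono fun _ h => h.2) measureReal_nonneg⟩

theorem condCdf_mono (μ : Measure ℝ) [IsFiniteMeasure μ] (S : Set ℝ) :
    Monotone (condCdf μ S) := fun _ _ h =>
  div_le_div_of_nonneg_right (measureReal_mono fun _ hs => ⟨hs.1.trans h, hs.2⟩) measureReal_nonneg

theorem condCdf_eq_cdf_cond (μ : Measure ℝ) [IsFiniteMeasure μ] {S : Set ℝ}
    (hS : MeasurableSet S) (h0 : μ S ≠ 0) (t : ℝ) : condCdf μ S t = cdf μ[|S] t := by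
  have : IsProbabilityMeasure μ[|S] := cond_isProbabilityMeasure h0
  have hinter : {s | s ≤ t ∧ s ∈ S} = S ∩ Set.Iic t := Set.ext fun s => and_comm
  rw [cdf_eq_real, condCdf, hinter, div_eq_inv_mul, measureReal_def μ[|S], cond_apply hS,
    ENNReal.toReal_mul, ENNReal.toReal_inv, measureReal_def, measureReal_def]

theorem nullSingletonClass_cond (μ : Measure ℝ) [NullSingletonClass μ] (S : Set ℝ) :
    NullSingletonClass μ[|S] := ⟨fun x => cond_absolutelyContinuous (measure_singleton x)⟩

/-- Away from a null set, `condCdf μ S` is strictly increasing on `S`. -/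
theorem measure_gt_condCdf_le (μ : Measure ℝ) [IsFiniteMeasure μ] [NullSingletonClass μ]
    {S : Set ℝ} (hS : MeasurableSet S) (q : ℝ) :
    μ {t | t ∈ S ∧ q < t ∧ condCdf μ S t ≤ condCdf μ S q} = 0 := by
  by_cases h0 : μ S = 0
  · exact measure_mono_null (fun t ht => ht.1) h0
  have : IsProbabilityMeasure μ[|S] := cond_isProbabilityMeasure h0
  have := nullSingletonClass_cond μ S
  have h := measure_gt_cdf_le_cdf μ[|S] q
  rw [cond_apply hS] at h
  simp only [condCdf_eq_cdf_cond μ hS h0]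
  simpa [measure_ne_top, Set.inter_def] using h

theorem measure_condCdf_preimage (μ : Measure ℝ) [IsFiniteMeasure μ] [NullSingletonClass μ]
    {S B : Set ℝ} (hS : MeasurableSet S) (hB : MeasurableSet B) :
    μ (S ∩ condCdf μ S ⁻¹' B) = μ S * unifLaw B := by
  by_cases h0 : μ S = 0
  · rw [h0, zero_mul]
    exact measure_mono_null Set.inter_subset_left h0
  have : IsProbabilityMeasure μ[|S] := cond_isProbabilityMeasure h0
  have := nullSingletonClass_cond μ S
  rw [← map_cdf_eq_unifLaw μ[|S], ← funext (condCdf_eq_cdf_cond μ hS h0),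
    Measure.map_apply (condCdf_mono μ S).measurable hB, cond_apply hS, ← mul_assoc,
    ENNReal.mul_inv_cancel h0 (measure_ne_top μ S), one_mul]

theorem measure_condCdf_fiber (μ : Measure ℝ) [IsFiniteMeasure μ] [NullSingletonClass μ]
    {J : ℝ → ℕ} (hJ : Measurable J) (T : Set ℕ) {B : Set ℝ} (hB : MeasurableSet B) :
    μ {t | J t ∈ T ∧ condCdf μ {s | J s = J t} t ∈ B} = μ (J ⁻¹' T) * unifLaw B := by
  have hS (j : ℕ) : MeasurableSet {s | J s = j} := hJ (measurableSet_singleton j)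
  have h1 : {t | J t ∈ T ∧ condCdf μ {s | J s = J t} t ∈ B} =
      ⋃ j : T, {s | J s = j} ∩ condCdf μ {s | J s = j} ⁻¹' B := by
    ext t
    simp
  have h2 : J ⁻¹' T = ⋃ j : T, {s | J s = j} := by
    ext t
    simp
  have hdisj : Pairwise (Function.onFun Disjoint fun j : T => {s | J s = j}) := fun i j hij =>
    Set.disjoint_left.2 fun t hi hj => hij (Subtype.ext (hi.symm.trans hj))
  rw [h1, h2, measure_iUnion hdisj fun j => hS j, ← ENNReal.tsum_mul_right,
    measure_iUnion (fun i j hij => (hdisj hij).mono Set.inter_subset_left Set.inter_subset_left)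
      fun j => (hS j).inter ((condCdf_mono μ _).measurable hB)]
  exact tsum_congr fun j => measure_condCdf_preimage μ (hS j) hB

theorem measurable_condCdf_fiber {E : Type*} [MeasurableSpace E] (μ : Measure ℝ) [SFinite μ]
    {K : E × ℝ → ℕ} (hK : Measurable K) :
    Measurable fun x : (E × ℕ) × ℝ => condCdf μ {s | K (x.1.1, s) = x.1.2} x.2 := by
  have h : MeasurableSet {y : ((E × ℕ) × ℝ) × ℝ | K (y.1.1.1, y.2) = y.1.1.2} :=
    measurableSet_eq_fun (by fun_prop) (by fun_prop)
  have h' : MeasurableSet {y : ((E × ℕ) × ℝ) × ℝ | y.2 ≤ y.1.2} :=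
    measurableSet_le (by fun_prop) (by fun_prop)
  exact (measurable_measure_prodMk_left (h'.inter h)).ennreal_toReal.div
    (measurable_measure_prodMk_left h).ennreal_toReal

/-- Conditionally on `V` and the value of `J`, the law of `U` has no atoms; its distribution
function at `U` is a uniform variable independent of `(V, J)` from which `U` can be recovered. -/
theorem exists_uniform_indepFun_prodMk {Ω E : Type*} {mΩ : MeasurableSpace Ω}
    [mE : MeasurableSpace E] (P : Measure Ω) [IsProbabilityMeasure P] {V : Ω → E} {U : Ω → ℝ}
    {J : Ω → ℕ} (hV : Measurable V) (hU : Measurable U) (hlaw : P.map U = unifLaw)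
    (hind : IndepFun V U P)
    (hJ : Measurable[MeasurableSpace.comap (fun ω => (V ω, U ω)) inferInstance] J) :
    ∃ Z : Ω → ℝ, Measurable[MeasurableSpace.comap (fun ω => (V ω, U ω)) inferInstance] Z ∧
      (∀ ω, Z ω ∈ Set.Icc (0 : ℝ) 1) ∧ P.map Z = unifLaw ∧
      IndepFun (fun ω => (V ω, J ω)) Z P ∧
      ∀ q, ∃ S : Set (E × ℕ × ℝ), MeasurableSet S ∧
        P {ω | ¬(U ω ≤ q ↔ (V ω, J ω, Z ω) ∈ S)} = 0 := by
  obtain ⟨K, hK, rfl⟩ := hJ.exists_eq_measurable_comp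
  have hR := measurable_condCdf_fiber unifLaw hK
  set W : E × ℝ → ℝ := fun x => condCdf unifLaw {s | K (x.1, s) = K x} x.2
  have hWm : Measurable W :=
    hR.comp (f := fun x : E × ℝ => ((x.1, K x), x.2)) (by fun_prop)
  have hVU : Measurable fun ω => (V ω, U ω) := hV.prodMk hU
  have hmap : P.map (fun ω => (V ω, U ω)) = (P.map V).prod unifLaw := by
    rw [← hlaw]
    exact hind.map_prod_eq_prod_map_map hV.aemeasurable hU.aemeasurable
  have : IsProbabilityMeasure (P.map V) := Measure.isProbabilityMeasure_map hV.aemeasurable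
  have hpre {A : Set (E × ℝ)} (hA : MeasurableSet A) :
      P ((fun ω => (V ω, U ω)) ⁻¹' A) = ((P.map V).prod unifLaw) A := by
    rw [← hmap, Measure.map_apply hVU hA]
  have hKe (e : E) : Measurable fun s => K (e, s) := by fun_prop
  have key (D : Set (E × ℕ)) (hD : MeasurableSet D) (B : Set ℝ) (hB : MeasurableSet B) :
      P {ω | (V ω, K (V ω, U ω)) ∈ D ∧ W (V ω, U ω) ∈ B} =
        P {ω | (V ω, K (V ω, U ω)) ∈ D} * unifLaw B := by
    have hA : MeasurableSet {x : E × ℝ | (x.1, K x) ∈ D} :=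
      (measurable_fst.prodMk hK) hD
    have h1 := hpre hA
    have h2 := hpre (hA.inter (hWm hB))
    rw [Measure.prod_apply hA] at h1
    rw [Measure.prod_apply (hA.inter (hWm hB))] at h2
    refine h2.trans ?_
    change _ = P ((fun ω => (V ω, U ω)) ⁻¹' {x : E × ℝ | (x.1, K x) ∈ D}) * _
    rw [h1, ← lintegral_mul_const _ (measurable_measure_prodMk_left hA)]
    exact lintegral_congr fun e =>
      measure_condCdf_fiber unifLaw (hKe e) {j | (e, j) ∈ D} hB
  have hlawW (B : Set ℝ) (hB : MeasurableSet B) : P {ω | W (V ω, U ω) ∈ B} = unifLaw B := by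
    simpa using key Set.univ .univ B hB
  refine ⟨fun ω => W (V ω, U ω), hWm.comp (comap_measurable _), fun ω => condCdf_mem_Icc _ _ _,
    ?_, ?_, fun q => ?_⟩
  · ext B hB
    exact (Measure.map_apply (hWm.comp hVU) hB).trans (hlawW B hB)
  · rw [indepFun_iff_measure_inter_preimage_eq_mul]
    intro D B hD hB
    exact (key D hD B hB).trans (by rw [← hlawW B hB]; rfl)
  · refine ⟨{x | x.2.2 ≤ condCdf unifLaw {s | K (x.1, s) = x.2.1} q}, ?_, ?_⟩
    · exact measurableSet_le (by fun_prop)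
        (hR.comp (f := fun x : E × ℕ × ℝ => ((x.1, x.2.1), q)) (by fun_prop))
    · have hA : MeasurableSet {x : E × ℝ | q < x.2 ∧
          W x ≤ condCdf unifLaw {s | K (x.1, s) = K x} q} :=
        (measurableSet_lt measurable_const measurable_snd).inter (measurableSet_le hWm
          (hR.comp (f := fun x : E × ℝ => ((x.1, K x), q)) (by fun_prop)))
      have h0 : P ((fun ω => (V ω, U ω)) ⁻¹' {x : E × ℝ | q < x.2 ∧
          W x ≤ condCdf unifLaw {s | K (x.1, s) = K x} q}) = 0 := by
        rw [hpre hA, Measure.measure_prod_null hA]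
        refine Filter.Eventually.of_forall fun e => ?_
        refine measure_mono_null (t := ⋃ j : ℕ, {t | t ∈ {s | K (e, s) = j} ∧ q < t ∧
          condCdf unifLaw {s | K (e, s) = j} t ≤ condCdf unifLaw {s | K (e, s) = j} q})
          (fun t ht => Set.mem_iUnion.2 ⟨K (e, t), rfl, ht.1, ht.2⟩)
          (measure_iUnion_null fun j => measure_gt_condCdf_le unifLaw
            (hKe e (measurableSet_singleton j)) q)
      refine measure_mono_null (fun ω hω => ?_) h0
      have hle : U ω ≤ q → W (V ω, U ω) ≤
          condCdf unifLaw {s | K (V ω, s) = K (V ω, U ω)} q := fun h => condCdf_mono _ _ h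
      simp only [Set.mem_ofPred_eq, Function.comp_apply] at hω
      by_cases h : U ω ≤ q
      · exact absurd (iff_of_true h (hle h)) hω
      · exact ⟨not_le.1 h, by_contra fun h' => hω (iff_of_false h h')⟩

theorem unifLaw_affine_preimage {c p : ℝ} (hp : 0 ≤ p) (B : Set ℝ) :
    ENNReal.ofReal p * unifLaw {z | c + p * z ∈ B} = volume (B ∩ Set.Ioc c (c + p)) := by
  rcases hp.eq_or_lt with rfl | hp
  · simp
  have h : {z | c + p * z ∈ B} ∩ Set.Ioc 0 1 =
      (p * ·) ⁻¹' ((c + ·) ⁻¹' (B ∩ Set.Ioc c (c + p))) := by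
    ext z
    have h1 : p * z ≤ p ↔ z ≤ 1 := mul_le_iff_le_one_right hp
    have h2 : 0 < p * z ↔ 0 < z := mul_pos_iff_of_pos_left hp
    simp [h1, h2]
  rw [unifLaw, ← Measure.restrict_congr_set Ioc_ae_eq_Icc, Measure.restrict_apply' measurableSet_Ioc,
    h, Real.volume_preimage_mul_left hp.ne', measure_preimage_add, abs_of_pos (inv_pos.2 hp),
    ← mul_assoc, ← ENNReal.ofReal_mul hp.le, mul_inv_cancel₀ hp.ne', ENNReal.ofReal_one, one_mul]

theorem measureReal_Iio_add_singleton (ν : Measure ℕ) [IsFiniteMeasure ν] (j : ℕ) :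
    ν.real (Set.Iio j) + ν.real {j} = ν.real (Set.Iic j) := by
  rw [← measureReal_union (by simp) (measurableSet_singleton j)]
  congr 1
  ext i
  simp [le_iff_lt_or_eq]

/-- The consecutive intervals of lengths `ν {j}` exhaust `[0,1]` up to a null set. -/
theorem tsum_volume_inter_Ioc (ν : Measure ℕ) [IsProbabilityMeasure ν] {B : Set ℝ}
    (hB : MeasurableSet B) :
    ∑' j, volume (B ∩ Set.Ioc (ν.real (Set.Iio j)) (ν.real (Set.Iic j))) = unifLaw B := by
  set I : ℕ → Set ℝ := fun j => Set.Ioc (ν.real (Set.Iio j)) (ν.real (Set.Iic j))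
  have hIm (j : ℕ) : MeasurableSet (I j) := measurableSet_Ioc
  have hlt {i j : ℕ} (h : i < j) : Disjoint (I i) (I j) := by
    refine Set.disjoint_left.2 fun x hi hj => ?_
    have : ν.real (Set.Iic i) ≤ ν.real (Set.Iio j) :=
      measureReal_mono fun k hk => lt_of_le_of_lt hk h
    exact absurd (hi.2.trans this) (not_le.2 hj.1)
  have hdisj : Pairwise (Function.onFun Disjoint I) := fun i j hij =>
    hij.lt_or_gt.elim hlt fun h => (hlt h).symm
  have hvol : volume (⋃ j, I j) = 1 := by
    rw [measure_iUnion hdisj hIm, ← measure_univ (μ := ν), ← Set.iUnion_of_singleton ℕ,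
      measure_iUnion (fun i j hij => Set.disjoint_singleton.2 hij) measurableSet_singleton]
    refine tsum_congr fun j => ?_
    rw [Real.volume_Ioc, ← measureReal_Iio_add_singleton, add_sub_cancel_left,
      ofReal_measureReal]
  have hsub : ⋃ j, I j ⊆ Set.Icc 0 1 := Set.iUnion_subset fun j x hx =>
    ⟨measureReal_nonneg.trans hx.1.le, hx.2.trans measureReal_le_one⟩
  have hae : (⋃ j, I j : Set ℝ) =ᵐ[volume] Set.Icc (0 : ℝ) 1 :=
    ae_eq_of_subset_of_measure_ge hsub (by simp [hvol]) (MeasurableSet.iUnion hIm).nullMeasurableSet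
      (by simp)
  rw [unifLaw, Measure.restrict_apply hB, ← measure_congr ((ae_eq_refl B).inter hae),
    Set.inter_iUnion, measure_iUnion (fun i j hij =>
      (hdisj hij).mono Set.inter_subset_right Set.inter_subset_right) fun j => hB.inter (hIm j)]

/-- A discrete variable `J` and a uniform variable `Z₀` independent of it can be glued into a single
uniform variable which determines both of them. -/
theorem exists_uniform_glue {Ω E : Type*} {mΩ : MeasurableSpace Ω} [mE : MeasurableSpace E]
    (P : Measure Ω) [IsProbabilityMeasure P] {V : Ω → E} {J : Ω → ℕ} {Z₀ : Ω → ℝ}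
    (hJ : Measurable J) (hZ₀ : Measurable Z₀) (hV : Measurable V)
    (hlaw : P.map Z₀ = unifLaw) (hmem : ∀ ω, Z₀ ω ∈ Set.Icc (0 : ℝ) 1)
    (hind : IndepFun (fun ω => (V ω, J ω)) Z₀ P) (hVJ : IndepFun V J P) :
    ∃ g : ℕ × ℝ → ℝ, Measurable g ∧ (∀ ω, g (J ω, Z₀ ω) ∈ Set.Icc (0 : ℝ) 1) ∧
      P.map (fun ω => g (J ω, Z₀ ω)) = unifLaw ∧
      IndepFun (fun ω => g (J ω, Z₀ ω)) V P ∧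
      (∀ j, ∃ S : Set ℝ, MeasurableSet S ∧ P {ω | ¬(J ω = j ↔ g (J ω, Z₀ ω) ∈ S)} = 0) ∧
      ∃ h : ℕ × ℝ → ℝ, Measurable h ∧ P {ω | Z₀ ω ≠ h (J ω, g (J ω, Z₀ ω))} = 0 := by
  set ν := P.map J
  have : IsProbabilityMeasure ν := Measure.isProbabilityMeasure_map hJ.aemeasurable
  set c : ℕ → ℝ := fun j => ν.real (Set.Iio j)
  set p : ℕ → ℝ := fun j => ν.real {j}
  have hp0 (j : ℕ) : 0 ≤ p j := measureReal_nonneg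
  have hcp (j : ℕ) : c j + p j = ν.real (Set.Iic j) := measureReal_Iio_add_singleton ν j
  have hcp1 (j : ℕ) : c j + p j ≤ 1 := (hcp j).trans_le measureReal_le_one
  have hlt {i j : ℕ} (h : i < j) : c i + p i ≤ c j := (hcp i).trans_le
    (measureReal_mono fun k hk => lt_of_le_of_lt hk h)
  set g : ℕ × ℝ → ℝ := fun x => c x.1 + p x.1 * x.2 with hg
  have hgm : Measurable g := by fun_prop
  set Z : Ω → ℝ := fun ω => g (J ω, Z₀ ω) with hZ
  have hZm : Measurable Z := hgm.comp (hJ.prodMk hZ₀)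
  have hZIcc (ω : Ω) : Z ω ∈ Set.Icc (c (J ω)) (c (J ω) + p (J ω)) :=
    ⟨le_add_of_nonneg_right (mul_nonneg (hp0 _) (hmem ω).1),
      add_le_add_right (mul_le_of_le_one_right (hp0 _) (hmem ω).2) _⟩
  have key (C : Set E) (hC : MeasurableSet C) (B : Set ℝ) (hB : MeasurableSet B) :
      P (V ⁻¹' C ∩ Z ⁻¹' B) = P (V ⁻¹' C) * unifLaw B := by
    have hpart : V ⁻¹' C ∩ Z ⁻¹' B =
        ⋃ j, (fun ω => (V ω, J ω)) ⁻¹' (C ×ˢ {j}) ∩ Z₀ ⁻¹' {z | c j + p j * z ∈ B} := by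
      ext ω
      simp [hZ, hg, and_assoc]
    have hBm (j : ℕ) : MeasurableSet {z | c j + p j * z ∈ B} :=
      (show Measurable fun z : ℝ => c j + p j * z by fun_prop) hB
    have hCm (j : ℕ) : MeasurableSet (C ×ˢ {j} : Set (E × ℕ)) :=
      hC.prod (measurableSet_singleton j)
    rw [hpart, measure_iUnion]
    · rw [← tsum_volume_inter_Ioc ν hB, ← ENNReal.tsum_mul_left]
      refine tsum_congr fun j => ?_
      rw [hind.measure_inter_preimage_eq_mul _ _ (hCm j) (hBm j), Set.mk_preimage_prod,
        hVJ.measure_inter_preimage_eq_mul _ _ hC (measurableSet_singleton j),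
        ← Measure.map_apply hZ₀ (hBm j), hlaw, ← hcp, ← unifLaw_affine_preimage (hp0 j), mul_assoc,
        ← Measure.map_apply hJ (measurableSet_singleton j), ofReal_measureReal]
    · intro i j hij
      exact Set.disjoint_left.2 fun ω hi hj => hij (hi.1.2.symm.trans hj.1.2)
    · exact fun j => ((hV.prodMk hJ) (hCm j)).inter (hZ₀ (hBm j))
  have hZB (B : Set ℝ) (hB : MeasurableSet B) : P (Z ⁻¹' B) = unifLaw B := by
    simpa using key Set.univ .univ B hB
  have hends : P (Z ⁻¹' (Set.range c ∪ Set.range fun j => c j + p j)) = 0 := by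
    have hcount : (Set.range c ∪ Set.range fun j => c j + p j).Countable :=
      (Set.countable_range _).union (Set.countable_range _)
    rw [hZB _ hcount.measurableSet, hcount.measure_zero]
  have hZIoo (ω : Ω) (hω : ω ∉ Z ⁻¹' (Set.range c ∪ Set.range fun j => c j + p j)) :
      Z ω ∈ Set.Ioo (c (J ω)) (c (J ω) + p (J ω)) :=
    ⟨(hZIcc ω).1.lt_of_ne fun h => hω (.inl ⟨_, h⟩),
      (hZIcc ω).2.lt_of_ne fun h => hω (.inr ⟨_, h.symm⟩)⟩
  refine ⟨g, hgm, fun ω => ⟨measureReal_nonneg.trans (hZIcc ω).1, (hZIcc ω).2.trans (hcp1 _)⟩,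
    ?_, ?_, fun j => ⟨Set.Ioo (c j) (c j + p j), measurableSet_Ioo, ?_⟩,
    fun x => (x.2 - c x.1) / p x.1, by fun_prop, ?_⟩
  · ext B hB
    exact (Measure.map_apply hZm hB).trans (hZB B hB)
  · refine IndepFun.symm ?_
    rw [indepFun_iff_measure_inter_preimage_eq_mul]
    intro C B hC hB
    exact (key C hC B hB).trans (by rw [← hZB B hB])
  · refine measure_mono_null (fun ω hω => by_contra fun hend => hω ?_) hends
    have hI := hZIoo ω hend
    refine ⟨fun h => h ▸ hI, fun h => ?_⟩
    rcases lt_trichotomy (J ω) j with hij | hij | hij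
    · exact absurd (hlt hij) (not_le.2 (h.1.trans hI.2))
    · exact hij
    · exact absurd (hlt hij) (not_le.2 (hI.1.trans h.2))
  · refine measure_mono_null (fun ω hω => by_contra fun hend => hω ?_) hends
    have hI := hZIoo ω hend
    have hpos : p (J ω) ≠ 0 := by
      have := hI.1.trans hI.2
      linarith
    simp [hg, hpos]

/-- A countable partition is generated by an integer-valued labelling of its members. -/
theorem exists_comap_eq_generateFrom_partition {Ω : Type*} {Ps : Set (Set Ω)}
    (hcount : Ps.Countable) (hdisj : Ps.Pairwise Disjoint) (hcover : ⋃₀ Ps = Set.univ) :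
    ∃ J : Ω → ℕ, MeasurableSpace.comap J inferInstance = MeasurableSpace.generateFrom Ps := by
  obtain ⟨f, hf⟩ := Set.countable_iff_exists_injOn.1 hcount
  choose a ha hωa using fun ω => Set.mem_sUnion.1 (hcover ▸ Set.mem_univ ω)
  have hpre {A : Set Ω} (hA : A ∈ Ps) : (fun ω => f (a ω)) ⁻¹' {f A} = A := by
    ext ω
    refine ⟨fun h => hf (ha ω) hA h ▸ hωa ω, fun h => ?_⟩
    exact congrArg f (hdisj.eq (ha ω) hA (Set.not_disjoint_iff.2 ⟨ω, hωa ω, h⟩))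
  refine ⟨fun ω => f (a ω), le_antisymm ?_ ?_⟩
  · rw [← measurable_iff_comap_le]
    let := MeasurableSpace.generateFrom Ps
    refine measurable_to_countable fun ω => ?_
    rw [hpre (ha ω)]
    exact MeasurableSpace.measurableSet_generateFrom (ha ω)
  · exact MeasurableSpace.generateFrom_le fun A hA => ⟨{f A}, measurableSet_singleton _, hpre hA⟩

theorem measurableSet_of_zeroLambda_le_s13 {Ω : Type*} {m : MeasurableSpace Ω} {P : Measure Ω}
    {W : MeasurableSpace Ω} (hW : zeroLambda m P ≤ W) (hWm : W ≤ m) {A B : Set Ω}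
    (hA : MeasurableSet[m] A) (hB : MeasurableSet[W] B) (h : P {ω | ¬(ω ∈ A ↔ ω ∈ B)} = 0) :
    MeasurableSet[W] A := by
  have hnull {N : Set Ω} (hN : MeasurableSet[m] N) (h0 : P N = 0) : MeasurableSet[W] N :=
    hW N (MeasurableSpace.measurableSet_generateFrom ⟨hN, .inl h0⟩)
  have h1 : MeasurableSet[W] (A \ B) := hnull (hA.diff (hWm B hB))
    (measure_mono_null (fun ω hω => fun hiff : ω ∈ A ↔ ω ∈ B => hω.2 (hiff.1 hω.1)) h)
  have h2 : MeasurableSet[W] (B \ A) := hnull ((hWm B hB).diff hA)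
    (measure_mono_null (fun ω hω => fun hiff : ω ∈ A ↔ ω ∈ B => hω.2 (hiff.2 hω.1)) h)
  have : A = (B \ (B \ A)) ∪ (A \ B) := by
    ext ω
    simp only [Set.mem_union, Set.mem_sdiff]
    tauto
  rw [this]
  exact (hB.diff h2).union h1

theorem measurable_of_zeroLambda_le {Ω E : Type*} [MeasurableSpace E] {m : MeasurableSpace Ω}
    {P : Measure Ω} {W : MeasurableSpace Ω} (hW : zeroLambda m P ≤ W) (hWm : W ≤ m) {f g : Ω → E}
    (hf : Measurable[m] f) (hg : Measurable[W] g) (h : P {ω | f ω ≠ g ω} = 0) :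
    Measurable[W] f := fun _ hS =>
  measurableSet_of_zeroLambda_le_s13 hW hWm (hf hS) (hg hS) <|
    measure_mono_null (fun ω hω => fun hfg : f ω = g ω => hω (by simp [hfg])) h

theorem sup_sigmaBar_eq {Ω E : Type*} [MeasurableSpace E] {m : MeasurableSpace Ω} {P : Measure Ω}
    {W : MeasurableSpace Ω} (hW : zeroLambda m P ≤ W) (ξ : Ω → E) :
    W ⊔ sigmaBar m P ξ = W ⊔ MeasurableSpace.comap ξ inferInstance := by
  rw [sigmaBar, ← sup_assoc, sup_eq_left.2 (hW.trans le_sup_left)]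

theorem sup_sigmaBarSet_eq {Ω : Type*} {m : MeasurableSpace Ω} {P : Measure Ω}
    {W : MeasurableSpace Ω} (hW : zeroLambda m P ≤ W) (Ps : Set (Set Ω)) :
    W ⊔ sigmaBarSet m P Ps = W ⊔ MeasurableSpace.generateFrom Ps := by
  rw [sigmaBarSet, ← sup_assoc, sup_eq_left.2 (hW.trans le_sup_left)]

/-- If `X` is conditionally non-atomic given `Y` and `Ps ⊆ X` is a countable partition of
`Ω`, then `X` is conditionally non-atomic given `Y ∨ σ̄(Ps)`; if moreover `σ̄(Ps) ⟂ Y`, then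
there is an `X`-measurable uniform `Z` with `Y + σ̄(Z) = X` and `σ̄(Ps) ⊆ σ̄(Z)`. -/
theorem stmt13 {Ω : Type*} {m : MeasurableSpace Ω} (P : Measure Ω) [IsProbabilityMeasure P]
    (X Y : MeasurableSpace Ω) (hXm : X ≤ m) (hYm : Y ≤ m)
    (hXc : zeroLambda m P ≤ X) (hYc : zeroLambda m P ≤ Y)
    (hYX : Y ≤ X)
    (hsep : ∃ ξ : Ω → ℝ, Measurable[m] ξ ∧ X = sigmaBar m P ξ)
    (hCNA : CondNonAtomic m P X Y)
    (Ps : Set (Set Ω)) (hPscount : Ps.Countable)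
    (hPsmeas : ∀ A ∈ Ps, MeasurableSet[X] A)
    (hPsdisj : Ps.Pairwise Disjoint)
    (hPscover : ⋃₀ Ps = Set.univ) :
    CondNonAtomic m P X (Y ⊔ sigmaBarSet m P Ps) ∧
    (Indep (sigmaBarSet m P Ps) Y P →
      ∃ Z : Ω → ℝ, Measurable[X] Z ∧ (∀ ω, Z ω ∈ Set.Icc (0 : ℝ) 1) ∧
        @MeasureTheory.Measure.map Ω ℝ m _ Z P = volume.restrict (Set.Icc (0 : ℝ) 1) ∧
        Indep (MeasurableSpace.comap Z inferInstance) Y P ∧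
        Y ⊔ sigmaBar m P Z = X ∧
        sigmaBarSet m P Ps ≤ sigmaBar m P Z) := by
  obtain ⟨U, hUX, -, hUlaw, hUind, hUsup⟩ := hCNA
  obtain ⟨J, hJPs⟩ := exists_comap_eq_generateFrom_partition hPscount hPsdisj hPscover
  have hJX : Measurable[X] J := by
    rw [measurable_iff_comap_le, hJPs]
    exact MeasurableSpace.generateFrom_le hPsmeas
  have hUm : Measurable[m] U := hUX.mono hXm le_rfl
  have hJm : Measurable[m] J := hJX.mono hXm le_rfl
  rw [sup_sigmaBar_eq hYc] at hUsup
  have hcomap {E : Type} [mE : MeasurableSpace E] (f : Ω → E) :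
      MeasurableSpace.comap (fun ω => (id ω, f ω)) (@Prod.instMeasurableSpace Ω E Y mE) =
        Y ⊔ MeasurableSpace.comap f mE := by
    rw [Prod.instMeasurableSpace, MeasurableSpace.comap_prodMk, MeasurableSpace.comap_id]
  have hid : @Measurable Ω Ω m Y id := measurable_id'' hYm
  obtain ⟨Z₀, hZ₀X, hZ₀mem, hZ₀law, hZ₀ind, hZ₀U⟩ :=
    exists_uniform_indepFun_prodMk (mE := Y) P hid hUm hUlaw
      (by
        rw [IndepFun_iff_Indep, MeasurableSpace.comap_id]
        exact hUind.symm)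
      (by rwa [hcomap, hUsup])
  rw [hcomap, hUsup] at hZ₀X
  have hZ₀m : Measurable[m] Z₀ := hZ₀X.mono hXm le_rfl
  have hWsup : Y ⊔ sigmaBarSet m P Ps = Y ⊔ MeasurableSpace.comap J inferInstance := by
    rw [sup_sigmaBarSet_eq hYc, hJPs]
  have hX : ∀ W : MeasurableSpace Ω, Y ≤ W → W ≤ X → Measurable[W] J → Measurable[W] Z₀ →
      W = X := by
    intro W hYW hWX hJW hZW
    refine le_antisymm hWX (hUsup ▸ sup_le hYW ?_)
    rw [← measurable_iff_comap_le]
    refine @measurable_of_Iic ℝ Ω _ _ _ W _ _ _ _ fun q => ?_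
    obtain ⟨S, hS, hSq⟩ := hZ₀U q
    have hid' : @Measurable Ω Ω W Y id := measurable_id'' hYW
    exact measurableSet_of_zeroLambda_le_s13 (hYc.trans hYW) (hWX.trans hXm) (hUm measurableSet_Iic)
      ((hid'.prodMk (hJW.prodMk hZW)) hS) hSq
  refine ⟨⟨Z₀, hZ₀X, hZ₀mem, hZ₀law, ?_, ?_⟩, fun hPsind => ?_⟩
  · rw [IndepFun_iff_Indep, hcomap] at hZ₀ind
    rw [hWsup]
    exact hZ₀ind.symm
  · rw [sup_sigmaBar_eq (hYc.trans le_sup_left), hWsup]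
    refine hX _ (le_sup_left.trans le_sup_left)
      (sup_le (sup_le hYX hJX.comap_le) hZ₀X.comap_le) ?_ ?_
    · exact measurable_iff_comap_le.2 (le_sup_right.trans le_sup_left)
    · exact measurable_iff_comap_le.2 le_sup_right
  · obtain ⟨g, hg, hgmem, hglaw, hgind, hgJ, h, hh, hgh⟩ :=
      exists_uniform_glue (mE := Y) P hJm hZ₀m hid hZ₀law hZ₀mem hZ₀ind
        (by
          rw [IndepFun_iff_Indep, MeasurableSpace.comap_id, hJPs]
          exact (indep_of_indep_of_le_left hPsind le_sup_left).symm)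
    set Z : Ω → ℝ := fun ω => g (J ω, Z₀ ω)
    have hZX : Measurable[X] Z := hg.comp (hJX.prodMk hZ₀X)
    have hbarX : sigmaBar m P Z ≤ X := sup_le hZX.comap_le hXc
    have hZbar : Measurable[sigmaBar m P Z] Z := measurable_iff_comap_le.2 le_sup_left
    have hJbar : Measurable[sigmaBar m P Z] J := by
      refine @measurable_to_countable' ℕ Ω _ _ (sigmaBar m P Z) _ fun j => ?_
      obtain ⟨S, hS, hSj⟩ := hgJ j
      exact measurableSet_of_zeroLambda_le_s13 le_sup_right (hbarX.trans hXm)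
        (hJm (measurableSet_singleton j)) (hZbar hS) hSj
    have hZ₀bar : Measurable[sigmaBar m P Z] Z₀ :=
      measurable_of_zeroLambda_le le_sup_right (hbarX.trans hXm) hZ₀m
        (hh.comp (hJbar.prodMk hZbar)) hgh
    refine ⟨Z, hZX, hgmem, hglaw, ?_, ?_, ?_⟩
    · rwa [IndepFun_iff_Indep, MeasurableSpace.comap_id] at hgind
    · exact hX _ le_sup_left (sup_le hYX hbarX) (hJbar.mono le_sup_right le_rfl)
        (hZ₀bar.mono le_sup_right le_rfl)
    · rw [sigmaBarSet, ← hJPs]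
      exact sup_le hJbar.comap_le le_sup_right
end
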